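/- arXiv:2407.07199 — 5 statements merged into one kernel-verified Lean document; each statement's English description precedes it below -/
import Mathlib

section
/- Let d ≥ 1 be an integer, s ∈ (0,1), and let R = 2√π · Γ(d/2 + 1)^{1/d}. Define for p ∈ ℤ^d the quantity T̃_p = (2π)^{-d} ∫_{B_R(0)} |ξ|^{2s} e^{i p·ξ} dξ, where B_R(0) ⊂ ℝ^d is the closed ball of radius R centered at the origin. Then T̃_p = O(|p|^{-(d+1)/2}) as |p| → ∞; that is, there exist constants C > 0 and P ≥ 1 such that for all p ∈ ℤ^d with |p| ≥ P one has |T̃_p| ≤ C |p|^{-(d+1)/2}. -/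
open MeasureTheory

/-- Euclidean norm of an integer vector `p : Fin d → ℤ`. -/
noncomputable def znorm (d : ℕ) (p : Fin d → ℤ) : ℝ :=
  Real.sqrt (∑ i, ((p i : ℝ)) ^ 2)

/-- The spectral approximation of the stiffness matrix of the fractional Laplacian:
`T̃_p = (2π)^{-d} ∫_{B_R(0)} |ξ|^{2s} e^{i p·ξ} dξ`. -/
noncomputable def Tspec (d : ℕ) (s : ℝ) (R : ℝ) (p : Fin d → ℤ) : ℂ :=
  ((2 * Real.pi) ^ d : ℝ)⁻¹ •
    ∫ ξ : EuclideanSpace ℝ (Fin d) in Metric.closedBall 0 R,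
      ((‖ξ‖ ^ (2 * s) : ℝ) : ℂ) * Complex.exp (Complex.I * (∑ i, (p i : ℝ) * ξ i))

/-- The oscillating factor `exp (i l sin θ)`. -/
noncomputable def oscPhase (l θ : ℝ) : ℂ := Complex.exp (Complex.I * (l * Real.sin θ : ℝ))

lemma norm_oscPhase (l θ : ℝ) : ‖oscPhase l θ‖ = 1 := by
  rw [oscPhase, mul_comm, Complex.norm_exp_ofReal_mul_I]

lemma continuous_oscPhase (l : ℝ) : Continuous (oscPhase l) := by
  unfold oscPhase; fun_prop

lemma hasDerivAt_oscPhase (l θ : ℝ) :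
    HasDerivAt (oscPhase l) (Complex.I * l * (Real.cos θ * oscPhase l θ)) θ := by
  have h := (((Real.hasDerivAt_sin θ).const_mul l).ofReal_comp.const_mul Complex.I).cexp
  refine h.congr_deriv ?_
  simp only [oscPhase]; push_cast; ring

lemma oscPhase_integral_by_parts (l a b : ℝ) (u u' : ℝ → ℝ)
    (hu : ∀ x ∈ Set.uIcc a b, HasDerivAt u (u' x) x) (hu' : ContinuousOn u' (Set.uIcc a b)) :
    Complex.I * l * ∫ x in a..b, ((u x * Real.cos x : ℝ) : ℂ) * oscPhase l x =
      u b * oscPhase l b - u a * oscPhase l a - ∫ x in a..b, (u' x : ℂ) * oscPhase l x := by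
  have := intervalIntegral.integral_mul_deriv_eq_deriv_mul (a := a) (b := b)
    (u := fun x => (u x : ℂ)) (v := oscPhase l) (u' := fun x => (u' x : ℂ))
    (fun x hx => (hu x hx).ofReal_comp) (fun x _ => hasDerivAt_oscPhase l x)
    (Complex.continuous_ofReal.comp_continuousOn hu').intervalIntegrable
    (by
      have := continuous_oscPhase l
      exact Continuous.intervalIntegrable (by fun_prop) _ _)
  rw [← this, ← intervalIntegral.integral_const_mul]
  congr 1; ext x; push_cast; ring

/-- The oscillatory integral of `f` against `exp (i l sin θ)` over `[-π/2, π/2]`. -/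
noncomputable def oscInt (l : ℝ) (f : ℝ → ℝ) : ℂ :=
  ∫ x in (-(Real.pi/2))..(Real.pi/2), (f x : ℂ) * oscPhase l x

lemma oscInt_sub (l : ℝ) {f g : ℝ → ℝ} (hf : Continuous f) (hg : Continuous g) (a b : ℝ) :
    oscInt l (fun x => a * f x - b * g x) = a * oscInt l f - b * oscInt l g := by
  have := continuous_oscPhase l
  unfold oscInt
  rw [← intervalIntegral.integral_const_mul, ← intervalIntegral.integral_const_mul,
    ← intervalIntegral.integral_sub]
  · congr 1; ext x; push_cast; ring
  all_goals exact Continuous.intervalIntegrable (by fun_prop) _ _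

lemma norm_oscInt_le (l : ℝ) {f : ℝ → ℝ} (hf : ∀ x, |f x| ≤ 1) : ‖oscInt l f‖ ≤ Real.pi := by
  have := intervalIntegral.norm_integral_le_of_norm_le_const (C := 1)
    (a := -(Real.pi/2)) (b := Real.pi/2) (f := fun x => (f x : ℂ) * oscPhase l x)
    (fun x _ => by simpa [norm_oscPhase] using hf x)
  have h2 : |Real.pi / 2 - -(Real.pi/2)| = Real.pi := by
    rw [abs_of_pos] <;> linarith [Real.pi_pos]
  rw [h2, one_mul] at this
  exact this

/-- Integration by parts on the half period. -/
lemma oscInt_by_parts (l : ℝ) (u u' : ℝ → ℝ) (hu : ∀ x, HasDerivAt u (u' x) x)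
    (hu' : Continuous u') :
    Complex.I * l * oscInt l (fun x => u x * Real.cos x) =
      u (Real.pi/2) * oscPhase l (Real.pi/2) - u (-(Real.pi/2)) * oscPhase l (-(Real.pi/2))
        - oscInt l u' :=
  oscPhase_integral_by_parts l _ _ u u' (fun x _ => hu x) hu'.continuousOn

lemma oscInt_cos_recurrence (l : ℝ) (n : ℕ) :
    Complex.I * l * oscInt l (fun x => Real.cos x ^ (n + 2)) =
      (n + 1) * oscInt l (fun x => Real.cos x ^ n * Real.sin x) := by
  have := oscInt_by_parts l (fun x => Real.cos x ^ (n + 1))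
    (fun x => (0:ℝ) * 1 - (n + 1 : ℝ) * (Real.cos x ^ n * Real.sin x))
    (fun x => ((Real.hasDerivAt_cos x).pow (n + 1)).congr_deriv (by push_cast; simp; ring))
    (by fun_prop)
  rw [oscInt_sub l (by fun_prop) (by fun_prop)] at this
  simpa [← pow_succ] using this

lemma oscInt_cos_sin_recurrence (l : ℝ) (n : ℕ) :
    Complex.I * l * oscInt l (fun x => Real.cos x ^ (n + 2) * Real.sin x) =
      (n + 1) * oscInt l (fun x => Real.cos x ^ n)
        - (n + 2) * oscInt l (fun x => Real.cos x ^ (n + 2)) := by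
  have := oscInt_by_parts l (fun x => Real.cos x ^ (n + 1) * Real.sin x)
    (fun x => (n + 2 : ℝ) * (Real.cos x ^ (n + 2)) - (n + 1 : ℝ) * (Real.cos x ^ n))
    (fun x => (((Real.hasDerivAt_cos x).pow (n + 1)).mul (Real.hasDerivAt_sin x)).congr_deriv (by
      have := Real.sin_sq_add_cos_sq x
      push_cast; simp
      linear_combination (-(n + 1) * Real.cos x ^ n) * this ))
    (by fun_prop)
  rw [oscInt_sub l (by fun_prop) (by fun_prop)] at this
  have e : (fun x => Real.cos x ^ (n + 1) * Real.sin x * Real.cos x)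
    = (fun x => Real.cos x ^ (n + 2) * Real.sin x) := by ext x; ring
  rw [e] at this
  rw [this]; simp

lemma norm_oscInt_of_mul_le {m : ℝ} (hm : 1 ≤ m) {z : ℂ} {A : ℝ} {k : ℕ}
    (h : ‖Complex.I * ((m ^ 2 : ℝ) : ℂ) * z‖ ≤ A / m ^ k) : ‖z‖ ≤ A / m ^ (k + 2) := by
  have hm0 : 0 < m := by linarith
  rw [norm_mul, norm_mul, Complex.norm_I, one_mul, Complex.norm_real, Real.norm_of_nonneg (by positivity),
    le_div_iff₀ (by positivity)] at h
  rw [le_div_iff₀ (by positivity)]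
  calc _ = _ := by ring
    _ ≤ _ := h

lemma norm_integral_oscPhase_of_monotone (l a b : ℝ) (hl : 0 ≤ l) (hab : a ≤ b) (u u' : ℝ → ℝ)
    (hu : ∀ x ∈ Set.uIcc a b, HasDerivAt u (u' x) x) (hu' : ContinuousOn u' (Set.uIcc a b))
    (hpos : ∀ x ∈ Set.uIcc a b, 0 ≤ u' x) :
    l * ‖∫ x in a..b, ((u x * Real.cos x : ℝ) : ℂ) * oscPhase l x‖ ≤ 2 * (|u a| + |u b|) := by
  have h1 : ‖∫ x in a..b, (u' x : ℂ) * oscPhase l x‖ ≤ u b - u a := by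
    rw [← intervalIntegral.integral_eq_sub_of_hasDerivAt hu hu'.intervalIntegrable]
    apply intervalIntegral.norm_integral_le_of_norm_le hab _ hu'.intervalIntegrable
    refine Filter.Eventually.of_forall fun x hx => ?_
    rw [norm_mul, norm_oscPhase, mul_one, Complex.norm_real, Real.norm_of_nonneg]
    exact hpos x (Set.uIoc_subset_uIcc (Set.uIoc_of_le hab ▸ hx))
  have h2 := congrArg norm (oscPhase_integral_by_parts l a b u u' hu hu')
  rw [norm_mul, norm_mul, Complex.norm_I, one_mul, Complex.norm_real, Real.norm_of_nonneg hl] at h2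
  rw [h2]
  have h3 := norm_sub_le ((u b : ℂ) * oscPhase l b - u a * oscPhase l a)
    (∫ x in a..b, (u' x : ℂ) * oscPhase l x)
  have h4 := norm_sub_le ((u b : ℂ) * oscPhase l b) (u a * oscPhase l a)
  simp only [norm_mul, norm_oscPhase, mul_one, Complex.norm_real, Real.norm_eq_abs] at h4
  linarith [le_abs_self (u b), neg_abs_le (u a)]

lemma norm_oscInt_sin_add_le (m : ℝ) (hm : 1 ≤ m) (σ : ℝ) (hσ : |σ| = 1) :
    ‖oscInt (m ^ 2) (fun x => Real.sin x + σ)‖ ≤ (4 * Real.pi + 4) / m := by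
  have hm0 : 0 < m := by linarith
  have hpi := Real.pi_gt_three
  have hδ0 : 0 < 1 / m := by positivity
  have hδ1 : 1 / m ≤ 1 := by rw [div_le_one hm0]; exact hm
  set δ := 1 / m with hδ
  set c := Real.pi / 2 - δ with hc
  have hc0 : 0 < c := by linarith
  have hcos : 2 / Real.pi * δ ≤ Real.cos c := by
    rw [hc, Real.cos_pi_div_two_sub]
    exact Real.mul_le_sin hδ0.le (by linarith)
  have hcos0 : 0 < Real.cos c := lt_of_lt_of_le (by positivity) hcos
  have hσ1 : ∀ y, |Real.sin y + σ| ≤ 2 := fun y => by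
    have := abs_add_le (Real.sin y) σ
    have := Real.abs_sin_le_one y
    linarith
  have hsσ : ∀ y, 0 ≤ 1 + σ * Real.sin y := fun y => by
    have h := Real.abs_sin_le_one y
    have : |σ * Real.sin y| ≤ 1 := by rw [abs_mul, hσ, one_mul]; exact h
    linarith [neg_abs_le (σ * Real.sin y)]
  have hcospos : ∀ x ∈ Set.uIcc (-c) c, 0 < Real.cos x := fun x hx => by
    rw [Set.uIcc_of_le (by linarith)] at hx
    exact Real.cos_pos_of_mem_Ioo ⟨by linarith [hx.1], by linarith [hx.2]⟩
  have hcont := continuous_oscPhase (m ^ 2)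
  have hint : ∀ a b, IntervalIntegrable
      (fun x => ((Real.sin x + σ : ℝ) : ℂ) * oscPhase (m ^ 2) x) volume a b := fun a b =>
    Continuous.intervalIntegrable (by fun_prop) _ _
  have hmid : ‖∫ x in (-c)..c, ((Real.sin x + σ : ℝ) : ℂ) * oscPhase (m ^ 2) x‖
      ≤ 4 * Real.pi / m := by
    have := norm_integral_oscPhase_of_monotone (m ^ 2) (-c) c (by positivity) (by linarith)
      (fun x => (Real.sin x + σ) / Real.cos x) (fun x => (1 + σ * Real.sin x) / Real.cos x ^ 2)
      (fun x hx => (((Real.hasDerivAt_sin x).add_const σ).div (Real.hasDerivAt_cos x)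
        (hcospos x hx).ne').congr_deriv (by
          congr 1; have := Real.sin_sq_add_cos_sq x; linear_combination this))
      (ContinuousOn.div (by fun_prop) (by fun_prop)
        (fun x hx => pow_ne_zero _ (hcospos x hx).ne'))
      (fun x hx => div_nonneg (hsσ x) (by positivity))
    rw [intervalIntegral.integral_congr (g := fun x => ((Real.sin x + σ : ℝ) : ℂ) *
      oscPhase (m ^ 2) x) (fun x hx => by
        simp only; rw [div_mul_cancel₀ _ (hcospos x hx).ne'])] at this
    have hb : ∀ y, Real.cos y = Real.cos c → |(Real.sin y + σ) / Real.cos y| ≤ Real.pi * m := by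
      intro y hy
      rw [hy, abs_div, abs_of_pos hcos0, div_le_iff₀ hcos0]
      calc _ ≤ 2 := hσ1 y
        _ = Real.pi * m * (2 / Real.pi * δ) := by rw [hδ]; field_simp
        _ ≤ _ := by gcongr
    have h1 := hb c rfl
    have h2 := hb (-c) (Real.cos_neg c)
    rw [le_div_iff₀ hm0]
    refine le_of_mul_le_mul_left ?_ hm0
    calc _ = _ := by ring
      _ ≤ _ := this
      _ ≤ _ := by linarith
  have hout : ∀ a b, |b - a| = δ →
      ‖∫ x in a..b, ((Real.sin x + σ : ℝ) : ℂ) * oscPhase (m ^ 2) x‖ ≤ 2 * δ := fun a b hab => by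
    rw [← hab]
    refine intervalIntegral.norm_integral_le_of_norm_le_const fun x _ => ?_
    rw [norm_mul, norm_oscPhase, mul_one, Complex.norm_real]
    exact hσ1 x
  have h1 := hout (-(Real.pi / 2)) (-c) (by
    rw [show -c - -(Real.pi / 2) = δ by rw [hc]; ring, abs_of_pos hδ0])
  have h2 := hout c (Real.pi / 2) (by
    rw [show Real.pi / 2 - c = δ by rw [hc]; ring, abs_of_pos hδ0])
  unfold oscInt
  rw [← intervalIntegral.integral_add_adjacent_intervals (hint _ c) (hint _ _),
    ← intervalIntegral.integral_add_adjacent_intervals (hint _ (-c)) (hint _ _)]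
  refine (norm_add₃_le).trans ?_
  have : (4 * Real.pi + 4) / m = 4 * Real.pi / m + 4 * δ := by rw [hδ]; ring
  rw [this]
  linarith

lemma norm_oscInt_zero_le (m : ℝ) (hm : 1 ≤ m) :
    ‖oscInt (m ^ 2) (fun x => Real.cos x ^ 0)‖ ≤ (4 * Real.pi + 4) / m ^ (0 + 1) ∧
    ‖oscInt (m ^ 2) (fun x => Real.cos x ^ 0 * Real.sin x)‖ ≤ (4 * Real.pi + 4) / m ^ (0 + 1) := by
  have h1 := norm_oscInt_sin_add_le m hm 1 (by simp)
  have h2 := norm_oscInt_sin_add_le m hm (-1) (by simp)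
  have e1 := oscInt_sub (m ^ 2) (f := fun x => Real.sin x + 1) (g := fun x => Real.sin x + -1)
    (by fun_prop) (by fun_prop) (1 / 2) (1 / 2)
  have e2 := oscInt_sub (m ^ 2) (f := fun x => Real.sin x + 1) (g := fun x => Real.sin x + -1)
    (by fun_prop) (by fun_prop) (1 / 2) (-(1 / 2))
  have f1 : (fun x => 1 / 2 * (Real.sin x + 1) - 1 / 2 * (Real.sin x + -1))
    = fun x => Real.cos x ^ 0 := by ext x; ring
  have f2 : (fun x => 1 / 2 * (Real.sin x + 1) - -(1 / 2) * (Real.sin x + -1))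
    = fun x => Real.cos x ^ 0 * Real.sin x := by ext x; ring
  rw [f1] at e1
  rw [f2] at e2
  rw [e1, e2, zero_add, pow_one]
  constructor <;>
  · refine (norm_sub_le _ _).trans ?_
    simp only [norm_mul, Complex.norm_real]
    norm_num
    linarith

lemma norm_oscInt_one_le (m : ℝ) (hm : 1 ≤ m) :
    ‖oscInt (m ^ 2) (fun x => Real.cos x ^ 1)‖ ≤ (2 + Real.pi) / m ^ (1 + 1) ∧
    ‖oscInt (m ^ 2) (fun x => Real.cos x ^ 1 * Real.sin x)‖ ≤ (2 + Real.pi) / m ^ (1 + 1) := by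
  have hpi := Real.pi_pos
  have key : ∀ u u' : ℝ → ℝ, (∀ x, HasDerivAt u (u' x) x) → Continuous u' →
      (∀ x, |u x| ≤ 1) → (∀ x, |u' x| ≤ 1) →
      ‖oscInt (m ^ 2) (fun x => u x * Real.cos x)‖ ≤ (2 + Real.pi) / m ^ (0 + 2) := by
    intro u u' hu hu' h1 h2
    refine norm_oscInt_of_mul_le hm ?_
    rw [oscInt_by_parts _ u u' hu hu', pow_zero, div_one]
    refine (norm_sub_le _ _).trans <| add_le_add ((norm_sub_le _ _).trans ?_) (norm_oscInt_le _ h2)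
    simp only [norm_mul, norm_oscPhase, mul_one, Complex.norm_real, Real.norm_eq_abs]
    linarith [h1 (Real.pi / 2), h1 (-(Real.pi / 2))]
  constructor
  · have := key (fun _ => 1) (fun _ => 0) (fun x => hasDerivAt_const x _) continuous_const
      (by simp) (by simp)
    simpa using this
  · have := key Real.sin Real.cos Real.hasDerivAt_sin Real.continuous_cos
      Real.abs_sin_le_one Real.abs_cos_le_one
    simpa [mul_comm] using this

lemma exists_norm_oscInt_le (n : ℕ) : ∃ K : ℝ, ∀ m : ℝ, 1 ≤ m →
    ‖oscInt (m ^ 2) (fun x => Real.cos x ^ n)‖ ≤ K / m ^ (n + 1) ∧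
    ‖oscInt (m ^ 2) (fun x => Real.cos x ^ n * Real.sin x)‖ ≤ K / m ^ (n + 1) := by
  induction n using Nat.twoStepInduction with
  | zero => exact ⟨_, norm_oscInt_zero_le⟩
  | one => exact ⟨_, norm_oscInt_one_le⟩
  | more n ih _ =>
    obtain ⟨K, hK⟩ := ih
    have hK0 : 0 ≤ K := by simpa using (norm_nonneg _).trans (hK 1 le_rfl).1
    refine ⟨(n + 1) * K + (n + 2) * ((n + 1) * K), fun m hm => ?_⟩
    have hm0 : 0 < m := by linarith
    have hn1 : ‖((n : ℂ) + 1)‖ = n + 1 := by exact_mod_cast Complex.norm_natCast (n + 1)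
    have hn2 : ‖((n : ℂ) + 2)‖ = n + 2 := by exact_mod_cast Complex.norm_natCast (n + 2)
    have h1 : ‖oscInt (m ^ 2) (fun x => Real.cos x ^ (n + 2))‖ ≤
        ((n + 1) * K) / m ^ (n + 1 + 2) := by
      refine norm_oscInt_of_mul_le hm ?_
      rw [oscInt_cos_recurrence, norm_mul, hn1, mul_div_assoc]
      exact mul_le_mul_of_nonneg_left (hK m hm).2 (by positivity)
    refine ⟨h1.trans (by gcongr; linarith [show 0 ≤ (n + 2) * ((n + 1) * K) by positivity]), ?_⟩
    refine norm_oscInt_of_mul_le (k := n + 1) hm ?_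
    rw [oscInt_cos_sin_recurrence]
    refine (norm_sub_le _ _).trans ?_
    rw [norm_mul, norm_mul, hn1, hn2, add_div, mul_div_assoc, mul_div_assoc]
    refine add_le_add (mul_le_mul_of_nonneg_left (hK m hm).1 (by positivity))
      (mul_le_mul_of_nonneg_left (h1.trans ?_) (by positivity))
    gcongr <;> omega

/-- The oscillatory integral with weight `cos ^ n` decays like `l ^ (-(n + 1) / 2)`. -/
lemma exists_norm_oscInt_cos_pow_le (n : ℕ) : ∃ K : ℝ, 0 ≤ K ∧ ∀ l : ℝ, 0 < l →
    ‖oscInt l (fun x => Real.cos x ^ n)‖ ≤ K / √l ^ (n + 1) := by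
  obtain ⟨K, hK⟩ := exists_norm_oscInt_le n
  refine ⟨max K Real.pi, le_max_of_le_right Real.pi_pos.le, fun l hl => ?_⟩
  have hl' := Real.sqrt_pos.2 hl
  rcases le_total 1 l with h | h
  · have := (hK √l (by simpa using h)).1
    rw [Real.sq_sqrt hl.le] at this
    exact this.trans (by gcongr; exact le_max_left _ _)
  · refine (norm_oscInt_le l fun x => ?_).trans ?_
    · rw [abs_pow]; exact pow_le_one₀ (abs_nonneg _) (Real.abs_cos_le_one x)
    · rw [le_div_iff₀ (by positivity)]
      calc _ ≤ Real.pi * 1 := by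
            gcongr; exact pow_le_one₀ hl'.le (by simpa using h)
        _ ≤ _ := by simp

/-- The measurable equivalence `ℝ × ℝⁿ ≃ ℝⁿ⁺¹` splitting off the first coordinate. -/
noncomputable def euclideanConsEquiv (n : ℕ) :
    EuclideanSpace ℝ (Fin (n + 1)) ≃ᵐ ℝ × EuclideanSpace ℝ (Fin n) :=
  ((MeasurableEquiv.toLp 2 (Fin (n + 1) → ℝ)).symm.trans
    (MeasurableEquiv.piFinSuccAbove (fun _ => ℝ) 0)).trans
    ((MeasurableEquiv.refl ℝ).prodCongr (MeasurableEquiv.toLp 2 (Fin n → ℝ)))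

lemma measurePreserving_euclideanConsEquiv (n : ℕ) :
    MeasurePreserving (euclideanConsEquiv n) volume volume :=
  ((MeasurePreserving.id volume).prod (PiLp.volume_preserving_toLp (Fin n))).comp
    ((volume_preserving_piFinSuccAbove (fun _ => ℝ) 0).comp
      (PiLp.volume_preserving_ofLp (Fin (n + 1))))

lemma euclideanConsEquiv_fst (n : ℕ) (x : EuclideanSpace ℝ (Fin (n + 1))) :
    (euclideanConsEquiv n x).1 = x 0 := rfl

lemma norm_sq_euclideanConsEquiv (n : ℕ) (x : EuclideanSpace ℝ (Fin (n + 1))) :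
    ‖x‖ ^ 2 = (euclideanConsEquiv n x).1 ^ 2 + ‖(euclideanConsEquiv n x).2‖ ^ 2 := by
  rw [EuclideanSpace.real_norm_sq_eq, EuclideanSpace.real_norm_sq_eq, Fin.sum_univ_succ]
  rfl

lemma exists_isometry_inner_eq (n : ℕ) (q : EuclideanSpace ℝ (Fin (n + 1))) (hq : q ≠ 0) :
    ∃ T : EuclideanSpace ℝ (Fin (n + 1)) ≃ₗᵢ[ℝ] EuclideanSpace ℝ (Fin (n + 1)),
      ∀ x, inner ℝ q x = ‖q‖ * T x 0 := by
  obtain ⟨b, hb⟩ := Orthonormal.exists_orthonormalBasis_extension_of_card_eq (𝕜 := ℝ)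
    (E := EuclideanSpace ℝ (Fin (n + 1))) (ι := Fin (n + 1)) (by simp)
    (v := fun _ => ‖q‖⁻¹ • q) (s := {0}) (by
      refine ⟨fun i => ?_, fun i j hij => absurd (Subsingleton.elim i j) hij⟩
      simp [Set.domRestrict, norm_smul, hq])
  refine ⟨b.repr, fun x => ?_⟩
  rw [b.repr_apply_apply, hb 0 rfl, real_inner_smul_left, ← mul_assoc,
    mul_inv_cancel₀ (norm_ne_zero_iff.2 hq), one_mul]

lemma volume_real_closedBall_euclidean (n : ℕ) (r : ℝ) (hr : 0 ≤ r) :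
    volume.real (Metric.closedBall (0 : EuclideanSpace ℝ (Fin n)) r) =
      r ^ n * volume.real (Metric.ball (0 : EuclideanSpace ℝ (Fin n)) 1) := by
  rw [Measure.real, Measure.addHaar_closedBall _ _ hr, ENNReal.toReal_mul,
    ENNReal.toReal_ofReal (by positivity)]
  simp [Measure.real]

/-- Slicing the integral of a plane wave over a ball. -/
lemma integral_closedBall_eq_integral_slices (n : ℕ) (r : ℝ) (hr : 0 ≤ r) (F : ℝ → ℂ)
    (hF : Continuous F) :
    ∫ x in Metric.closedBall (0 : EuclideanSpace ℝ (Fin (n + 1))) r, F (x 0) =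
      volume.real (Metric.ball (0 : EuclideanSpace ℝ (Fin n)) 1) *
        ∫ t in (-r)..r, F t * ((√(r ^ 2 - t ^ 2) ^ n : ℝ) : ℂ) := by
  set S : Set (ℝ × EuclideanSpace ℝ (Fin n)) := {z | z.1 ^ 2 + ‖z.2‖ ^ 2 ≤ r ^ 2} with hS
  have hSm : MeasurableSet S := (isClosed_le (by fun_prop) (by fun_prop)).measurableSet
  have hpre : Metric.closedBall (0 : EuclideanSpace ℝ (Fin (n + 1))) r
      = euclideanConsEquiv n ⁻¹' S := by
    ext x
    rw [mem_closedBall_zero_iff, Set.mem_preimage, hS, Set.mem_ofPred_eq,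
      ← norm_sq_euclideanConsEquiv, sq_le_sq₀ (norm_nonneg _) hr]
  have hFc : ContinuousOn (fun x : EuclideanSpace ℝ (Fin (n + 1)) => F (x 0))
      (Metric.closedBall 0 r) := by fun_prop
  have hint : IntegrableOn (fun z : ℝ × EuclideanSpace ℝ (Fin n) => F z.1) S := by
    have := hFc.integrableOn_compact (μ := volume) (isCompact_closedBall _ _)
    rw [hpre] at this
    exact ((measurePreserving_euclideanConsEquiv n).integrableOn_comp_preimage
      (euclideanConsEquiv n).measurableEmbedding).1 this
  rw [hpre]
  have h1 := (measurePreserving_euclideanConsEquiv n).setIntegral_preimage_emb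
    (euclideanConsEquiv n).measurableEmbedding (fun z => F z.1) S
  simp only [euclideanConsEquiv_fst] at h1
  rw [h1, ← integral_indicator hSm, Measure.volume_eq_prod, integral_prod _
    ((integrable_indicator_iff hSm).2 hint), intervalIntegral.integral_of_le (by linarith),
    ← integral_Icc_eq_integral_Ioc, ← integral_const_mul, ← integral_indicator measurableSet_Icc]
  congr 1
  ext t
  by_cases ht : t ∈ Set.Icc (-r) r
  · have ht2 : t ^ 2 ≤ r ^ 2 := sq_le_sq' ht.1 ht.2
    rw [Set.indicator_of_mem ht]
    have : ∀ y : EuclideanSpace ℝ (Fin n), S.indicator (fun z => F z.1) (t, y) =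
        (Metric.closedBall (0 : EuclideanSpace ℝ (Fin n)) √(r ^ 2 - t ^ 2)).indicator
          (fun _ => F t) y := fun y => by
      have : (t, y) ∈ S ↔ y ∈ Metric.closedBall (0 : EuclideanSpace ℝ (Fin n)) √(r ^ 2 - t ^ 2) := by
        rw [mem_closedBall_zero_iff, Real.le_sqrt (norm_nonneg _) (by linarith), hS, Set.mem_ofPred_eq]
        constructor <;> intro h <;> linarith
      by_cases h : (t, y) ∈ S
      · rw [Set.indicator_of_mem h, Set.indicator_of_mem (this.1 h)]
      · rw [Set.indicator_of_notMem h, Set.indicator_of_notMem (fun h' => h (this.2 h'))]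
    simp_rw [this]
    rw [integral_indicator Metric.isClosed_closedBall.measurableSet, setIntegral_const,
      volume_real_closedBall_euclidean n _ (Real.sqrt_nonneg _), Complex.real_smul]
    push_cast; ring
  · rw [Set.indicator_of_notMem ht]
    have : ∀ y : EuclideanSpace ℝ (Fin n), S.indicator (fun z => F z.1) (t, y) = 0 := fun y =>
      Set.indicator_of_notMem (fun h => ht (by
        rw [hS, Set.mem_ofPred_eq] at h
        exact Set.mem_Icc.2 (abs_le.1 (abs_le_of_sq_le_sq (by nlinarith [sq_nonneg ‖y‖]) hr)))) _
    simp_rw [this, integral_zero]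

lemma integral_slices_eq_oscInt (n : ℕ) (r l : ℝ) (hr : 0 ≤ r) :
    ∫ t in (-r)..r, Complex.exp (Complex.I * (l * t : ℝ)) * ((√(r ^ 2 - t ^ 2) ^ n : ℝ) : ℂ) =
      (r : ℂ) ^ (n + 1) * oscInt (l * r) (fun x => Real.cos x ^ (n + 1)) := by
  have h := intervalIntegral.integral_deriv_smul_comp
    (a := -(Real.pi / 2)) (b := Real.pi / 2) (f := fun x => r * Real.sin x)
    (f' := fun x => r * Real.cos x)
    (g := fun t => Complex.exp (Complex.I * (l * t : ℝ)) * ((√(r ^ 2 - t ^ 2) ^ n : ℝ) : ℂ))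
    (fun x _ => (Real.hasDerivAt_sin x).const_mul r) (by fun_prop) (by fun_prop)
  simp only [Real.sin_neg, Real.sin_pi_div_two, mul_neg, mul_one] at h
  rw [← h, oscInt, ← intervalIntegral.integral_const_mul]
  refine intervalIntegral.integral_congr fun x hx => ?_
  rw [Set.uIcc_of_le (by linarith [Real.pi_pos])] at hx
  have hc : 0 ≤ Real.cos x := Real.cos_nonneg_of_mem_Icc hx
  have e : √(r ^ 2 - (r * Real.sin x) ^ 2) = r * Real.cos x := by
    rw [show r ^ 2 - (r * Real.sin x) ^ 2 = (r * Real.cos x) ^ 2 by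
      linear_combination (-r ^ 2) * Real.sin_sq_add_cos_sq x]
    exact Real.sqrt_sq (by positivity)
  simp only [Function.comp, e, oscPhase, Complex.real_smul, mul_assoc]
  push_cast; ring

/-- The Fourier transform of the indicator function of a ball, in terms of `oscInt`. -/
lemma integral_closedBall_exp_inner (n : ℕ) (r : ℝ) (hr : 0 ≤ r)
    (q : EuclideanSpace ℝ (Fin (n + 1))) (hq : q ≠ 0) :
    ∫ x in Metric.closedBall (0 : EuclideanSpace ℝ (Fin (n + 1))) r,
        Complex.exp (Complex.I * (inner ℝ q x : ℝ)) =
      volume.real (Metric.ball (0 : EuclideanSpace ℝ (Fin n)) 1) *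
        ((r : ℂ) ^ (n + 1) * oscInt (‖q‖ * r) (fun x => Real.cos x ^ (n + 1))) := by
  obtain ⟨T, hT⟩ := exists_isometry_inner_eq n q hq
  rw [← integral_slices_eq_oscInt n r ‖q‖ hr, ← integral_closedBall_eq_integral_slices n r hr
    (fun t => Complex.exp (Complex.I * (‖q‖ * t : ℝ))) (by fun_prop),
    ← T.measurePreserving.setIntegral_preimage_emb T.toMeasurableEquiv.measurableEmbedding
      (fun x => Complex.exp (Complex.I * (‖q‖ * x 0 : ℝ)))]
  simp [hT]

/-- On bounded sets of radii, the Fourier transform of the indicator function of a ball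
decays like `‖q‖ ^ (-(d + 1) / 2)`, uniformly in the radius. -/
lemma exists_norm_integral_closedBall_exp_inner_le (n : ℕ) (R : ℝ) :
    ∃ K : ℝ, 0 ≤ K ∧ ∀ r : ℝ, 0 ≤ r → r ≤ R →
      ∀ q : EuclideanSpace ℝ (Fin (n + 1)), q ≠ 0 →
      ‖∫ x in Metric.closedBall (0 : EuclideanSpace ℝ (Fin (n + 1))) r,
        Complex.exp (Complex.I * (inner ℝ q x : ℝ))‖ ≤ K / √‖q‖ ^ (n + 2) := by
  obtain ⟨K, hK0, hK⟩ := exists_norm_oscInt_cos_pow_le (n + 1)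
  set V := volume.real (Metric.ball (0 : EuclideanSpace ℝ (Fin n)) 1) with hV
  have hV0 : 0 ≤ V := measureReal_nonneg
  refine ⟨V * (√R ^ n * K), by positivity, fun r hr hrR q hq => ?_⟩
  have hq0 : 0 < ‖q‖ := norm_pos_iff.2 hq
  rw [integral_closedBall_exp_inner n r hr q hq, norm_mul, norm_mul, norm_pow, Complex.norm_real,
    Complex.norm_real, Real.norm_of_nonneg hr, Real.norm_of_nonneg hV0, mul_div_assoc]
  refine mul_le_mul_of_nonneg_left ?_ hV0
  rcases hr.eq_or_lt with rfl | hr0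
  · rw [zero_pow (by omega), zero_mul]; positivity
  have hsr : 0 < √r := Real.sqrt_pos.2 hr0
  have hsq : 0 < √‖q‖ := Real.sqrt_pos.2 hq0
  calc r ^ (n + 1) * ‖oscInt (‖q‖ * r) (fun x => Real.cos x ^ (n + 1))‖
      ≤ r ^ (n + 1) * (K / √(‖q‖ * r) ^ (n + 1 + 1)) := by gcongr; exact hK _ (by positivity)
    _ = (√r ^ 2) ^ (n + 1) * (K / (√‖q‖ * √r) ^ (n + 2)) := by
        rw [Real.sq_sqrt hr, Real.sqrt_mul hq0.le]
    _ = √r ^ n * K / √‖q‖ ^ (n + 2) := by field_simp; ring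
    _ ≤ √R ^ n * K / √‖q‖ ^ (n + 2) := by gcongr

/-- Layer-cake formula for `‖x‖ ^ a` times a bounded continuous function on a ball. -/
lemma integral_closedBall_rpow_norm_mul {E : Type*} [NormedAddCommGroup E] [NormedSpace ℝ E]
    [FiniteDimensional ℝ E] [MeasurableSpace E] [BorelSpace E] (μ : Measure E)
    [IsFiniteMeasureOnCompacts μ] [SFinite μ] (R a : ℝ) (ha : 0 < a) (g : E → ℂ)
    (hg : Continuous g) :
    ∫ x in Metric.closedBall (0 : E) R, ((‖x‖ ^ a : ℝ) : ℂ) * g x ∂μ =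
      ((R ^ a : ℝ) : ℂ) * (∫ x in Metric.closedBall (0 : E) R, g x ∂μ) -
        ∫ r in Set.Ioc 0 R, ((a * r ^ (a - 1) : ℝ) : ℂ) *
          ∫ x in Metric.closedBall (0 : E) r, g x ∂μ := by
  set B := Metric.closedBall (0 : E) R with hB
  have hBm : MeasurableSet B := Metric.isClosed_closedBall.measurableSet
  have hgB : IntegrableOn g B μ := hg.continuousOn.integrableOn_compact (isCompact_closedBall _ _)
  have hw : IntegrableOn (fun r : ℝ => ((a * r ^ (a - 1) : ℝ) : ℂ)) (Set.Ioc 0 R) := by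
    rcases le_or_gt R 0 with h | h
    · rw [Set.Ioc_eq_empty (not_lt.2 h)]; exact integrableOn_empty
    · exact ((intervalIntegrable_iff_integrableOn_Ioc_of_le h.le).1
        ((intervalIntegral.intervalIntegrable_rpow' (by linarith)).const_mul a)).ofReal
  set S : Set (E × ℝ) := {z | ‖z.1‖ ≤ z.2} with hS
  have hSm : MeasurableSet S := (isClosed_le (by fun_prop) (by fun_prop)).measurableSet
  have hint : Integrable (Function.uncurry fun (x : E) (r : ℝ) =>
      S.indicator (fun z => g z.1 * ((a * z.2 ^ (a - 1) : ℝ) : ℂ)) (x, r))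
      ((μ.restrict B).prod (volume.restrict (Set.Ioc 0 R))) :=
    (Integrable.mul_prod hgB hw).indicator hSm
  have hswap := integral_integral_swap hint
  have hl : ∀ x ∈ B, ∫ r in Set.Ioc 0 R,
      S.indicator (fun z => g z.1 * ((a * z.2 ^ (a - 1) : ℝ) : ℂ)) (x, r) =
      ((R ^ a : ℝ) : ℂ) * g x - ((‖x‖ ^ a : ℝ) : ℂ) * g x := fun x hx => by
    rw [hB, mem_closedBall_zero_iff] at hx
    have h1 : ∀ r, S.indicator (fun z => g z.1 * ((a * z.2 ^ (a - 1) : ℝ) : ℂ)) (x, r) =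
        (Set.Ici ‖x‖).indicator (fun r => g x * ((a * r ^ (a - 1) : ℝ) : ℂ)) r := fun r => rfl
    simp_rw [h1]
    rw [setIntegral_indicator measurableSet_Ici,
      setIntegral_congr_set ((ae_eq_refl _).inter Ioi_ae_eq_Ici.symm), Set.Ioc_inter_Ioi,
      max_eq_right (norm_nonneg x), integral_const_mul, integral_complex_ofReal,
      ← intervalIntegral.integral_of_le hx, intervalIntegral.integral_const_mul,
      integral_rpow (Or.inl (by linarith)), sub_add_cancel, mul_div_cancel₀ _ ha.ne']
    push_cast; ring
  have hr : ∀ r ∈ Set.Ioc 0 R, ∫ x in B,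
      S.indicator (fun z => g z.1 * ((a * z.2 ^ (a - 1) : ℝ) : ℂ)) (x, r) ∂μ =
      ((a * r ^ (a - 1) : ℝ) : ℂ) * ∫ x in Metric.closedBall (0 : E) r, g x ∂μ := fun r hr => by
    have h1 : ∀ x, S.indicator (fun z => g z.1 * ((a * z.2 ^ (a - 1) : ℝ) : ℂ)) (x, r) =
        (Metric.closedBall (0 : E) r).indicator
          (fun x => g x * ((a * r ^ (a - 1) : ℝ) : ℂ)) x := fun x => by
      by_cases h : ‖x‖ ≤ r
      · rw [Set.indicator_of_mem (show (x, r) ∈ S from h),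
          Set.indicator_of_mem (mem_closedBall_zero_iff.2 h)]
      · rw [Set.indicator_of_notMem (show (x, r) ∉ S from h),
          Set.indicator_of_notMem (mt mem_closedBall_zero_iff.1 h)]
    simp_rw [h1]
    rw [setIntegral_indicator Metric.isClosed_closedBall.measurableSet,
      Set.inter_eq_right.2 (Metric.closedBall_subset_closedBall hr.2), integral_mul_const, mul_comm]
  rw [setIntegral_congr_fun hBm hl, setIntegral_congr_fun measurableSet_Ioc hr] at hswap
  have hc : IntegrableOn (fun x : E => ((‖x‖ ^ a : ℝ) : ℂ) * g x) B μ := by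
    refine ContinuousOn.integrableOn_compact (isCompact_closedBall _ _) (Continuous.continuousOn ?_)
    exact (Complex.continuous_ofReal.comp
      (continuous_norm.rpow_const fun _ => Or.inr ha.le)).mul hg
  rw [integral_sub (hgB.const_mul _) hc, integral_const_mul] at hswap
  rw [← hswap]; ring

lemma norm_integral_closedBall_rpow_norm_mul_le {E : Type*} [NormedAddCommGroup E]
    [NormedSpace ℝ E] [FiniteDimensional ℝ E] [MeasurableSpace E] [BorelSpace E] (μ : Measure E)
    [IsFiniteMeasureOnCompacts μ] [SFinite μ] (R a M : ℝ) (hR : 0 ≤ R) (ha : 0 < a) (g : E → ℂ)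
    (hg : Continuous g)
    (hM : ∀ r, 0 ≤ r → r ≤ R → ‖∫ x in Metric.closedBall (0 : E) r, g x ∂μ‖ ≤ M) :
    ‖∫ x in Metric.closedBall (0 : E) R, ((‖x‖ ^ a : ℝ) : ℂ) * g x ∂μ‖ ≤ 2 * R ^ a * M := by
  rw [integral_closedBall_rpow_norm_mul μ R a ha g hg]
  have hRa : 0 ≤ R ^ a := Real.rpow_nonneg hR a
  have h1 : ‖((R ^ a : ℝ) : ℂ) * (∫ x in Metric.closedBall (0 : E) R, g x ∂μ)‖ ≤ R ^ a * M := by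
    rw [norm_mul, Complex.norm_real, Real.norm_of_nonneg hRa]
    exact mul_le_mul_of_nonneg_left (hM R hR le_rfl) hRa
  have hi : IntervalIntegrable (fun r : ℝ => a * r ^ (a - 1) * M) volume 0 R :=
    ((intervalIntegral.intervalIntegrable_rpow' (by linarith)).const_mul a).mul_const M
  have h2 : ‖∫ r in Set.Ioc 0 R, ((a * r ^ (a - 1) : ℝ) : ℂ) *
      ∫ x in Metric.closedBall (0 : E) r, g x ∂μ‖ ≤ ∫ r in Set.Ioc 0 R, a * r ^ (a - 1) * M := by
    refine norm_integral_le_of_norm_le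
      ((intervalIntegrable_iff_integrableOn_Ioc_of_le hR).1 hi) ?_
    filter_upwards [ae_restrict_mem measurableSet_Ioc] with r hr
    have h0 : 0 ≤ a * r ^ (a - 1) := mul_nonneg ha.le (Real.rpow_nonneg hr.1.le _)
    rw [norm_mul, Complex.norm_real, Real.norm_of_nonneg h0]
    exact mul_le_mul_of_nonneg_left (hM r hr.1.le hr.2) h0
  have h3 : ∫ r in Set.Ioc 0 R, a * r ^ (a - 1) * M = R ^ a * M := by
    rw [← intervalIntegral.integral_of_le hR, intervalIntegral.integral_mul_const,
      intervalIntegral.integral_const_mul, integral_rpow (Or.inl (by linarith)), sub_add_cancel,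
      mul_div_cancel₀ _ ha.ne', Real.zero_rpow ha.ne', sub_zero]
  rw [h3] at h2
  exact (norm_sub_le _ _).trans (by linarith)

theorem stmt_0 (d : ℕ) (hd : 1 ≤ d) (s : ℝ) (hs0 : 0 < s) (hs1 : s < 1)
    (R : ℝ) (hR : R = 2 * Real.sqrt Real.pi * (Real.Gamma ((d : ℝ) / 2 + 1)) ^ ((1 : ℝ) / d)) :
    ∃ C > (0 : ℝ), ∃ P : ℝ, 1 ≤ P ∧ ∀ p : Fin d → ℤ,
      P ≤ znorm d p →
      ‖Tspec d s R p‖ ≤ C * (znorm d p) ^ (-(((d : ℝ) + 1) / 2)) := by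
  have hR0 : 0 ≤ R := by
    have : 0 < Real.Gamma ((d : ℝ) / 2 + 1) := Real.Gamma_pos_of_pos (by positivity)
    rw [hR]; positivity
  obtain ⟨n, rfl⟩ : ∃ n, d = n + 1 := ⟨d - 1, by omega⟩
  obtain ⟨K, hK0, hK⟩ := exists_norm_integral_closedBall_exp_inner_le n R
  refine ⟨((2 * Real.pi) ^ (n + 1))⁻¹ * (2 * R ^ (2 * s) * K) + 1, by positivity, 1, le_rfl,
    fun p hp => ?_⟩
  set q : EuclideanSpace ℝ (Fin (n + 1)) := WithLp.toLp 2 fun i => (p i : ℝ) with hq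
  have hqn : ‖q‖ = znorm (n + 1) p := by
    rw [EuclideanSpace.norm_eq, znorm]
    simp [hq]
  have hq0 : 0 < ‖q‖ := by linarith
  have hin : ∀ x : EuclideanSpace ℝ (Fin (n + 1)),
      inner ℝ q x = ∑ i, (p i : ℝ) * x i := fun x => by
    simp [hq, PiLp.inner_apply, mul_comm]
  have hpow : ‖q‖ ^ (-((((n + 1 : ℕ) : ℝ) + 1) / 2)) = (√‖q‖ ^ (n + 2))⁻¹ := by
    rw [Real.rpow_neg hq0.le, Real.sqrt_eq_rpow, ← Real.rpow_natCast, ← Real.rpow_mul hq0.le]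
    congr 2; push_cast; ring
  have hb := norm_integral_closedBall_rpow_norm_mul_le volume R (2 * s) (K / √‖q‖ ^ (n + 2)) hR0
    (by positivity) (fun x => Complex.exp (Complex.I * (inner ℝ q x : ℝ))) (by fun_prop)
    (fun r h0 h1 => hK r h0 h1 q (norm_pos_iff.1 hq0))
  simp only [hin] at hb
  push_cast at hb
  rw [← hqn, hpow, Tspec, norm_smul, Real.norm_of_nonneg (by positivity)]
  push_cast
  calc _ ≤ ((2 * Real.pi) ^ (n + 1))⁻¹ * (2 * R ^ (2 * s) * (K / √‖q‖ ^ (n + 2))) :=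
        mul_le_mul_of_nonneg_left hb (by positivity)
    _ = ((2 * Real.pi) ^ (n + 1))⁻¹ * (2 * R ^ (2 * s) * K) * (√‖q‖ ^ (n + 2))⁻¹ := by ring
    _ ≤ _ := by gcongr; linarith
end

section
/- Let s ∈ (0,1) and, for p ∈ ℤ, define T̃_p = (1/(2π)) ∫_{−π}^{π} |ξ|^{2s} e^{i p ξ} dξ. Then T̃_p = O(|p|^{-(1+min(1,2s))}) as |p| → ∞ over the integers; that is, there exist C > 0 and P ≥ 1 such that |T̃_p| ≤ C |p|^{-(1+min(1,2s))} for all integers p with |p| ≥ P. -/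
open MeasureTheory intervalIntegral

/-- The one-dimensional spectral approximation of the stiffness matrix:
`T̃_p = (1/(2π)) ∫_{−π}^{π} |ξ|^{2s} e^{i p ξ} dξ`. -/
noncomputable def Tspec1 (s : ℝ) (p : ℤ) : ℂ :=
  ((1 / (2 * Real.pi) : ℝ) : ℂ) *
    ∫ ξ in (-Real.pi)..Real.pi,
      ((|ξ| ^ (2 * s) : ℝ) : ℂ) * Complex.exp (Complex.I * (p : ℂ) * (ξ : ℂ))

theorem norm_Tspec1_eq (s : ℝ) (hs : 0 < s) (p : ℤ) :
    ‖Tspec1 s p‖ =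
      Real.pi⁻¹ * |∫ x in (0 : ℝ)..Real.pi, x ^ (2 * s) * Real.cos (|(p : ℝ)| * x)| := by
  have hcont : Continuous fun ξ : ℝ =>
      ((|ξ| ^ (2 * s) : ℝ) : ℂ) * Complex.exp (Complex.I * (p : ℂ) * (ξ : ℂ)) := by
    have h : Continuous fun ξ : ℝ => |ξ| ^ (2 * s) :=
      continuous_abs.rpow_const fun _ => Or.inr (by positivity)
    fun_prop
  have key : (∫ ξ in (-Real.pi)..Real.pi,
      ((|ξ| ^ (2 * s) : ℝ) : ℂ) * Complex.exp (Complex.I * (p : ℂ) * (ξ : ℂ))) =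
      ((2 * ∫ x in (0 : ℝ)..Real.pi, x ^ (2 * s) * Real.cos (|(p : ℝ)| * x) : ℝ) : ℂ) := by
    rw [← integral_add_adjacent_intervals (hcont.intervalIntegrable _ 0)
      (hcont.intervalIntegrable 0 _), ← intervalIntegral.integral_const_mul,
      ← intervalIntegral.integral_ofReal]
    have hneg := intervalIntegral.integral_comp_neg (a := 0) (b := Real.pi) fun ξ : ℝ =>
      ((|ξ| ^ (2 * s) : ℝ) : ℂ) * Complex.exp (Complex.I * (p : ℂ) * (ξ : ℂ))
    rw [neg_zero] at hneg
    have hcont_neg := hcont.comp continuous_neg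
    simp only [Function.comp_def] at hcont_neg
    rw [← hneg, ← intervalIntegral.integral_add
      (hcont_neg.intervalIntegrable _ _) (hcont.intervalIntegrable _ _)]
    refine intervalIntegral.integral_congr fun x hx => ?_
    rw [Set.uIcc_of_le Real.pi_pos.le] at hx
    have hcos : Real.cos (|(p : ℝ)| * x) = Real.cos (p * x) := by
      rw [← Real.cos_abs (p * x), abs_mul, abs_of_nonneg hx.1]
    simp only [hcos, abs_neg, abs_of_nonneg hx.1]
    push_cast
    rw [← mul_add, mul_left_comm, Complex.two_cos, add_comm]
    congr 3 <;> ring_nf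
  rw [Tspec1, key, ← Complex.ofReal_mul, Complex.norm_real, Real.norm_eq_abs, ← mul_assoc,
    abs_mul, abs_of_pos (by positivity)]
  congr 1
  field_simp

theorem integral_rpow_mul_cos {a r : ℝ} (ha : 0 < a) (hr : r ≠ 0)
    (hsin : Real.sin (r * Real.pi) = 0) :
    ∫ x in (0 : ℝ)..Real.pi, x ^ a * Real.cos (r * x) =
      -(a / r) * ∫ x in (0 : ℝ)..Real.pi, x ^ (a - 1) * Real.sin (r * x) := by
  have h := intervalIntegral.integral_mul_deriv_eq_deriv_mul_of_hasDerivAt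
    (a := 0) (b := Real.pi) (u := fun x : ℝ => x ^ a) (v := fun x => Real.sin (r * x) / r)
    (u' := fun x => a * x ^ (a - 1)) (v' := fun x => Real.cos (r * x))
    (continuous_id.rpow_const fun _ => Or.inr ha.le).continuousOn
    (by fun_prop)
    (fun x hx => by
      rw [min_eq_left Real.pi_pos.le] at hx
      exact Real.hasDerivAt_rpow_const (Or.inl hx.1.ne'))
    (fun x _ => by
      convert (((hasDerivAt_id' x).const_mul r).sin.div_const r) using 1
      field_simp)
    ((intervalIntegrable_rpow' (by linarith)).const_mul _)
    (Continuous.intervalIntegrable (by fun_prop) _ _)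
  rw [h, hsin, mul_zero, Real.sin_zero, zero_div, mul_zero, mul_zero, sub_zero, zero_sub,
    neg_mul, ← intervalIntegral.integral_const_mul]
  congr 1
  refine intervalIntegral.integral_congr fun x _ => ?_
  ring

theorem abs_integral_rpow_mul_sin_le {b r ε c : ℝ} (hr : 0 < r) (hε : 0 < ε) (hc : ε ≤ c) :
    |∫ x in ε..c, x ^ b * Real.sin (r * x)| ≤ 2 * (c ^ b + ε ^ b) / r := by
  have hpos : ∀ x ∈ Set.uIcc ε c, 0 < x := fun x hx => by
    rw [Set.uIcc_of_le hc] at hx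
    exact hε.trans_le hx.1
  have hderiv : ∀ x ∈ Set.uIcc ε c, HasDerivAt (fun x : ℝ => x ^ b) (b * x ^ (b - 1)) x :=
    fun x hx => Real.hasDerivAt_rpow_const (Or.inl (hpos x hx).ne')
  have hint : IntervalIntegrable (fun x : ℝ => x ^ (b - 1)) volume ε c :=
    intervalIntegrable_rpow (Or.inr fun h => (hpos 0 h).false)
  have h := intervalIntegral.integral_mul_deriv_eq_deriv_mul
    (v := fun x => -Real.cos (r * x) / r) (v' := fun x => Real.sin (r * x)) hderiv
    (fun x _ => by
      convert (((hasDerivAt_id' x).const_mul r).cos.fun_neg.div_const r) using 1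
      field_simp)
    (hint.const_mul _) (Continuous.intervalIntegrable (by fun_prop) _ _)
  have hc0 : 0 < c := hε.trans_le hc
  have hcb : 0 < c ^ b := Real.rpow_pos_of_pos hc0 b
  have hεb : 0 < ε ^ b := Real.rpow_pos_of_pos hε b
  have hcos : ∀ x, |-Real.cos (r * x) / r| ≤ 1 / r := fun x => by
    rw [abs_div, abs_neg, abs_of_pos hr]
    gcongr
    exact Real.abs_cos_le_one _
  have hvar : |∫ x in ε..c, b * x ^ (b - 1) * (-Real.cos (r * x) / r)| ≤
      (c ^ b + ε ^ b) / r := by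
    calc _ ≤ ∫ x in ε..c, |b| / r * x ^ (b - 1) := by
          rw [← Real.norm_eq_abs]
          refine intervalIntegral.norm_integral_le_of_norm_le hc
            (Filter.Eventually.of_forall fun x hx => ?_) (hint.const_mul _)
          have hx0 : 0 < x := hε.trans hx.1
          have hxb : 0 < x ^ (b - 1) := Real.rpow_pos_of_pos hx0 _
          rw [Real.norm_eq_abs, abs_mul, abs_mul, abs_of_pos hxb]
          calc _ ≤ |b| * x ^ (b - 1) * (1 / r) := by gcongr; exact hcos x
            _ = _ := by ring
      _ = |∫ x in ε..c, b * x ^ (b - 1)| / r := by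
          rw [intervalIntegral.integral_const_mul, intervalIntegral.integral_const_mul, abs_mul,
            abs_of_nonneg (intervalIntegral.integral_nonneg hc fun x hx =>
              Real.rpow_nonneg (hε.le.trans hx.1) _)]
          ring
      _ ≤ _ := by
          rw [intervalIntegral.integral_eq_sub_of_hasDerivAt hderiv (hint.const_mul _)]
          gcongr
          rw [abs_le]
          constructor <;> linarith
  rw [h]
  have hbc : |c ^ b * (-Real.cos (r * c) / r)| ≤ c ^ b * (1 / r) := by
    rw [abs_mul, abs_of_pos hcb]
    gcongr
    exact hcos c
  have hbε : |ε ^ b * (-Real.cos (r * ε) / r)| ≤ ε ^ b * (1 / r) := by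
    rw [abs_mul, abs_of_pos hεb]
    gcongr
    exact hcos ε
  calc _ ≤ |c ^ b * (-Real.cos (r * c) / r)| + |ε ^ b * (-Real.cos (r * ε) / r)| +
        |∫ x in ε..c, b * x ^ (b - 1) * (-Real.cos (r * x) / r)| :=
        (abs_sub _ _).trans (add_le_add_left (abs_sub _ _) _)
    _ ≤ c ^ b * (1 / r) + ε ^ b * (1 / r) + (c ^ b + ε ^ b) / r := by gcongr
    _ = _ := by ring

theorem abs_integral_zero_rpow_mul_sin_le {b r ε : ℝ} (hb : -1 < b) (hε : 0 ≤ ε) :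
    |∫ x in (0 : ℝ)..ε, x ^ b * Real.sin (r * x)| ≤ ε ^ (b + 1) / (b + 1) := by
  calc _ ≤ ∫ x in (0 : ℝ)..ε, x ^ b := by
        rw [← Real.norm_eq_abs]
        refine intervalIntegral.norm_integral_le_of_norm_le hε
          (Filter.Eventually.of_forall fun x hx => ?_) (intervalIntegrable_rpow' hb)
        have hxb : 0 ≤ x ^ b := Real.rpow_nonneg hx.1.le _
        rw [Real.norm_eq_abs, abs_mul, abs_of_nonneg hxb]
        exact mul_le_of_le_one_right hxb (Real.abs_sin_le_one _)
    _ = _ := by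
        rw [integral_rpow (Or.inl hb), Real.zero_rpow (by linarith), sub_zero]

theorem abs_integral_rpow_sub_one_mul_sin_le {a r : ℝ} (ha : 0 < a) (hr : 1 ≤ r) :
    |∫ x in (0 : ℝ)..Real.pi, x ^ (a - 1) * Real.sin (r * x)| ≤
      (1 / a + 2 * (Real.pi ^ (a - 1) + 1)) * r ^ (-min 1 a) := by
  have hr0 : 0 < r := zero_lt_one.trans_le hr
  have hε : r⁻¹ ≤ Real.pi := (inv_le_one_of_one_le₀ hr).trans (by linarith [Real.pi_gt_three])
  have hint : ∀ c d, IntervalIntegrable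
      (fun x : ℝ => x ^ (a - 1) * Real.sin (r * x)) volume c d := fun c d =>
    (intervalIntegrable_rpow' (by linarith)).mul_continuousOn (by fun_prop)
  rw [← integral_add_adjacent_intervals (hint 0 r⁻¹) (hint r⁻¹ Real.pi)]
  have h₁ := abs_integral_zero_rpow_mul_sin_le (b := a - 1) (r := r) (by linarith)
    (inv_pos.2 hr0).le
  have h₂ := abs_integral_rpow_mul_sin_le (b := a - 1) hr0 (inv_pos.2 hr0) hε
  have hpow : r⁻¹ ^ a = r ^ (-a) := by rw [Real.inv_rpow hr0.le, Real.rpow_neg hr0.le]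
  have hsplit : r⁻¹ ^ (a - 1) / r = r ^ (-a) := by
    rw [← hpow, Real.rpow_sub_one (inv_pos.2 hr0).ne']
    field_simp
  have hale : r ^ (-a) ≤ r ^ (-min 1 a) :=
    Real.rpow_le_rpow_of_exponent_le hr (neg_le_neg (min_le_right _ _))
  have hone : r⁻¹ ≤ r ^ (-min 1 a) := by
    rw [← Real.rpow_neg_one]
    exact Real.rpow_le_rpow_of_exponent_le hr (neg_le_neg (min_le_left _ _))
  have hπ : 0 < Real.pi ^ (a - 1) := Real.rpow_pos_of_pos Real.pi_pos _
  rw [sub_add_cancel, hpow] at h₁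
  calc _ ≤ r ^ (-a) / a + 2 * (Real.pi ^ (a - 1) + r⁻¹ ^ (a - 1)) / r :=
        (abs_add_le _ _).trans (add_le_add h₁ h₂)
    _ = 1 / a * r ^ (-a) + 2 * (Real.pi ^ (a - 1) * r⁻¹ + r ^ (-a)) := by
        rw [← hsplit]
        ring
    _ ≤ 1 / a * r ^ (-min 1 a) + 2 * (Real.pi ^ (a - 1) * r ^ (-min 1 a) + r ^ (-min 1 a)) := by
        gcongr
    _ = _ := by ring

theorem stmt_1 (s : ℝ) (hs0 : 0 < s) (hs1 : s < 1) :
    ∃ C > (0 : ℝ), ∃ P : ℝ, 1 ≤ P ∧ ∀ p : ℤ, P ≤ |(p : ℝ)| →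
      ‖Tspec1 s p‖ ≤ C * |(p : ℝ)| ^ (-(1 + min 1 (2 * s))) := by
  have ha : 0 < 2 * s := by positivity
  have hπ : 0 < Real.pi ^ (2 * s - 1) := Real.rpow_pos_of_pos Real.pi_pos _
  refine ⟨Real.pi⁻¹ * (2 * s * (1 / (2 * s) + 2 * (Real.pi ^ (2 * s - 1) + 1))),
    by positivity, 1, le_rfl, fun p hp => ?_⟩
  have hp0 : 0 < |(p : ℝ)| := zero_lt_one.trans_le hp
  have hsin : Real.sin (|(p : ℝ)| * Real.pi) = 0 := by
    rw [← Int.cast_abs]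
    exact Real.sin_int_mul_pi _
  rw [norm_Tspec1_eq s hs0, integral_rpow_mul_cos ha hp0.ne' hsin, abs_mul, abs_neg,
    abs_of_pos (div_pos ha hp0), neg_add, Real.rpow_add hp0, Real.rpow_neg_one]
  calc _ ≤ Real.pi⁻¹ * (2 * s / |(p : ℝ)| * ((1 / (2 * s) + 2 * (Real.pi ^ (2 * s - 1) + 1)) *
        |(p : ℝ)| ^ (-min 1 (2 * s)))) := by
        gcongr
        exact abs_integral_rpow_sub_one_mul_sin_le ha hp
    _ = _ := by ring
end

section
/- Let s ∈ (0,1). Then, as λ → ∞ over the positive reals, ∫_0^1 t^{2s} cos(λ t) dt = sin(λ)/λ + 2s · cos(λ)/λ² − Γ(2s+1) sin(πs) · λ^{-(1+2s)} + O(λ^{-(2+2s)} + λ^{-3}); that is, there exist C > 0 and λ₀ ≥ 1 such that for all λ ≥ λ₀ the absolute difference between the integral and the three displayed terms is at most C(λ^{-(2+2s)} + λ^{-3}). -/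
open MeasureTheory intervalIntegral

/-- A primitive of `t ^ b * exp (-z t) - b (b - 1) (b - 2) / z ^ 3 * t ^ (b - 3) * exp (-z t)`,
obtained by integrating by parts three times. -/
theorem hasDerivAt_rpow_mul_cexp_primitive (b : ℝ) {z : ℂ} (hz : z ≠ 0) {t : ℝ} (ht : 0 < t) :
    HasDerivAt (fun t : ℝ => -(Complex.exp (-(z * t)) * (((t ^ b : ℝ) : ℂ) / z
        + b * ((t ^ (b - 1) : ℝ) : ℂ) / z ^ 2 + b * (b - 1) * ((t ^ (b - 2) : ℝ) : ℂ) / z ^ 3)))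
      (((t ^ b : ℝ) : ℂ) * Complex.exp (-(z * t))
        - b * (b - 1) * (b - 2) / z ^ 3 * (((t ^ (b - 3) : ℝ) : ℂ) * Complex.exp (-(z * t)))) t := by
  have hpow (c : ℝ) : HasDerivAt (fun t : ℝ => ((t ^ c : ℝ) : ℂ))
      ((c * t ^ (c - 1) : ℝ) : ℂ) t :=
    (Real.hasDerivAt_rpow_const (Or.inl ht.ne')).ofReal_comp
  have hexp : HasDerivAt (fun t : ℝ => Complex.exp (-(z * t)))
      (Complex.exp (-(z * t)) * -(z * 1)) t :=
    (((hasDerivAt_id t).ofReal_comp.const_mul z).neg).cexp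
  have h := (hexp.mul ((((hpow b).div_const z).add
    (((hpow (b - 1)).const_mul (b : ℂ)).div_const (z ^ 2))).add
    (((hpow (b - 2)).const_mul ((b : ℂ) * (b - 1))).div_const (z ^ 3)))).neg
  refine h.congr_deriv ?_
  rw [show b - 1 - 1 = b - 2 by ring, show b - 2 - 1 = b - 3 by ring]
  simp only [Pi.add_apply]
  push_cast
  field_simp
  ring

theorem norm_rpow_mul_cexp (b : ℝ) (z : ℂ) {t : ℝ} (ht : 0 < t) :
    ‖((t ^ b : ℝ) : ℂ) * Complex.exp (-(z * t))‖ = t ^ b * Real.exp (-z.re * t) := by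
  rw [norm_mul, Complex.norm_real, Real.norm_of_nonneg (Real.rpow_nonneg ht.le b),
    Complex.norm_exp]
  simp

theorem continuousOn_rpow_mul_cexp (b : ℝ) (z : ℂ) :
    ContinuousOn (fun t : ℝ => ((t ^ b : ℝ) : ℂ) * Complex.exp (-(z * t))) (Set.Ioi 0) := by
  refine ContinuousOn.mul ?_ (by fun_prop)
  exact Complex.continuous_ofReal.comp_continuousOn
    (continuousOn_id.rpow_const fun t ht => Or.inl (ne_of_gt ht))

theorem integrableOn_rpow_mul_cexp {b : ℝ} (hb : -1 < b) {z : ℂ} (hz : 0 < z.re) :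
    IntegrableOn (fun t : ℝ => ((t ^ b : ℝ) : ℂ) * Complex.exp (-(z * t))) (Set.Ioi 0) := by
  have h := integrableOn_rpow_mul_exp_neg_mul_rpow (p := 1) hb one_pos hz
  refine Integrable.mono' h
    ((continuousOn_rpow_mul_cexp b z).aestronglyMeasurable measurableSet_Ioi) ?_
  refine (ae_restrict_iff' measurableSet_Ioi).2 (.of_forall fun t ht => ?_)
  rw [norm_rpow_mul_cexp b z ht, Real.rpow_one]

theorem differentiableAt_integral_Ioi_rpow_mul_cexp {b : ℝ} (hb : -1 < b) {z : ℂ}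
    (hz : 0 < z.re) :
    DifferentiableAt ℂ
      (fun w : ℂ => ∫ t in Set.Ioi (0 : ℝ), ((t ^ b : ℝ) : ℂ) * Complex.exp (-(w * t))) z := by
  have hs : {w : ℂ | z.re / 2 < w.re} ∈ nhds z :=
    (isOpen_lt continuous_const Complex.continuous_re).mem_nhds (half_lt_self hz)
  have hbound := integrableOn_rpow_mul_exp_neg_mul_rpow (p := 1) (s := b + 1) (by linarith)
    one_pos (half_pos hz)
  have hmeas (w : ℂ) : AEStronglyMeasurable
      (fun t : ℝ => ((t ^ b : ℝ) : ℂ) * Complex.exp (-(w * t)))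
      (volume.restrict (Set.Ioi (0 : ℝ))) :=
    (continuousOn_rpow_mul_cexp b w).aestronglyMeasurable measurableSet_Ioi
  refine (hasDerivAt_integral_of_dominated_loc_of_deriv_le (μ := volume.restrict (Set.Ioi (0 : ℝ)))
    (F := fun (w : ℂ) (t : ℝ) => ((t ^ b : ℝ) : ℂ) * Complex.exp (-(w * t)))
    (F' := fun (w : ℂ) (t : ℝ) => ((t ^ b : ℝ) : ℂ) * Complex.exp (-(w * t)) * -(t : ℂ))
    hs (.of_forall hmeas) (integrableOn_rpow_mul_cexp hb hz)
    ((hmeas z).mul (by fun_prop)) ?_ hbound ?_).2.differentiableAt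
  · refine (ae_restrict_iff' measurableSet_Ioi).2 (.of_forall fun t ht w hw => ?_)
    have ht : 0 < t := ht
    have hw : z.re / 2 < w.re := hw
    rw [norm_mul, norm_rpow_mul_cexp b w ht, norm_neg, Complex.norm_real,
      Real.norm_of_nonneg ht.le, Real.rpow_add_one ht.ne', Real.rpow_one, mul_right_comm]
    gcongr
  · refine .of_forall fun t w _ => ?_
    have h := (((hasDerivAt_id w).mul_const (t : ℂ)).neg.cexp).const_mul ((t ^ b : ℝ) : ℂ)
    refine h.congr_deriv ?_
    simp [mul_assoc]

theorem one_div_mem_slitPlane {z : ℂ} (hz : 0 < z.re) : 1 / z ∈ Complex.slitPlane := by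
  have hz0 : z ≠ 0 := by
    rintro rfl
    simp at hz
  refine Complex.mem_slitPlane_iff.2 (Or.inl ?_)
  rw [one_div, Complex.inv_re]
  exact div_pos hz (Complex.normSq_pos.2 hz0)

/-- The Laplace transform of a power, on the whole right half-plane. -/
theorem integral_Ioi_rpow_mul_cexp {b : ℝ} (hb : -1 < b) {z : ℂ} (hz : 0 < z.re) :
    ∫ t in Set.Ioi (0 : ℝ), ((t ^ b : ℝ) : ℂ) * Complex.exp (-(z * t))
      = (1 / z) ^ ((b + 1 : ℝ) : ℂ) * Real.Gamma (b + 1) := by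
  have hU : IsOpen {w : ℂ | 0 < w.re} := isOpen_lt continuous_const Complex.continuous_re
  have hf : AnalyticOnNhd ℂ (fun w : ℂ =>
      ∫ t in Set.Ioi (0 : ℝ), ((t ^ b : ℝ) : ℂ) * Complex.exp (-(w * t))) {w : ℂ | 0 < w.re} :=
    DifferentiableOn.analyticOnNhd (fun w hw =>
      (differentiableAt_integral_Ioi_rpow_mul_cexp hb hw).differentiableWithinAt) hU
  have hg : AnalyticOnNhd ℂ (fun w : ℂ => (1 / w) ^ ((b + 1 : ℝ) : ℂ) * Real.Gamma (b + 1))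
      {w : ℂ | 0 < w.re} := by
    refine DifferentiableOn.analyticOnNhd (fun w (hw : 0 < w.re) => ?_) hU
    have hw0 : w ≠ 0 := by
      rintro rfl
      simp at hw
    exact ((((differentiableAt_const 1).div differentiableAt_id hw0).cpow
      (differentiableAt_const _) (one_div_mem_slitPlane hw)).mul_const _).differentiableWithinAt
  have hreal {r : ℝ} (hr : 0 < r) :
      ∫ t in Set.Ioi (0 : ℝ), ((t ^ b : ℝ) : ℂ) * Complex.exp (-(r * t))
        = (1 / (r : ℂ)) ^ ((b + 1 : ℝ) : ℂ) * Real.Gamma (b + 1) := by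
    rw [← Complex.Gamma_ofReal, ← Complex.integral_cpow_mul_exp_neg_mul_Ioi
      (by rw [Complex.ofReal_re]; linarith) hr]
    refine setIntegral_congr_fun measurableSet_Ioi fun t ht => ?_
    simp [Complex.ofReal_cpow (le_of_lt ht)]
  have htend : Filter.Tendsto (fun r : ℝ => (r : ℂ)) (nhdsWithin 1 (Set.Ioi 1))
      (nhdsWithin 1 {1}ᶜ) := by
    refine tendsto_nhdsWithin_of_tendsto_nhds_of_eventually_within _ ?_ ?_
    · exact (Complex.continuous_ofReal.tendsto' 1 1 (by simp)).mono_left nhdsWithin_le_nhds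
    · filter_upwards [self_mem_nhdsWithin] with r hr
      simpa using ne_of_gt hr
  refine hf.eqOn_of_preconnected_of_frequently_eq hg
    (convex_halfSpace_re_gt 0).isPreconnected (z₀ := 1) (by simp) ?_ hz
  refine htend.frequently (Filter.Eventually.frequently ?_)
  filter_upwards [self_mem_nhdsWithin] with r hr
  exact hreal (one_pos.trans hr)

theorem norm_rpow_mul_cexp_le (b : ℝ) {z : ℂ} (hz : 0 < z.re) {t : ℝ} (ht : 0 < t) :
    ‖((t ^ b : ℝ) : ℂ) * Complex.exp (-(z * t))‖ ≤ t ^ b := by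
  rw [norm_rpow_mul_cexp b z ht]
  refine mul_le_of_le_one_right (Real.rpow_nonneg ht.le b) (Real.exp_le_one_iff.2 ?_)
  nlinarith

theorem integrableOn_Ioi_one_rpow_mul_cexp {b : ℝ} (hb : b < -1) {z : ℂ} (hz : 0 < z.re) :
    IntegrableOn (fun t : ℝ => ((t ^ b : ℝ) : ℂ) * Complex.exp (-(z * t))) (Set.Ioi 1) := by
  refine Integrable.mono' (integrableOn_Ioi_rpow_of_lt hb one_pos)
    (((continuousOn_rpow_mul_cexp b z).mono
      (Set.Ioi_subset_Ioi zero_le_one)).aestronglyMeasurable measurableSet_Ioi) ?_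
  exact (ae_restrict_iff' measurableSet_Ioi).2
    (.of_forall fun t ht => norm_rpow_mul_cexp_le b hz (one_pos.trans ht))

theorem norm_integral_Ioi_one_rpow_mul_cexp_le {b : ℝ} (hb : b < -1) {z : ℂ} (hz : 0 < z.re) :
    ‖∫ t in Set.Ioi (1 : ℝ), ((t ^ b : ℝ) : ℂ) * Complex.exp (-(z * t))‖ ≤ -1 / (b + 1) := by
  have h := norm_integral_le_of_norm_le (integrableOn_Ioi_rpow_of_lt hb one_pos)
    ((ae_restrict_iff' measurableSet_Ioi).2
      (.of_forall fun t ht => norm_rpow_mul_cexp_le b hz (one_pos.trans ht)))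
  rwa [integral_Ioi_rpow_of_lt hb one_pos, Real.one_rpow] at h

theorem tendsto_rpow_mul_cexp_atTop (b : ℝ) {z : ℂ} (hz : 0 < z.re) :
    Filter.Tendsto (fun t : ℝ => ((t ^ b : ℝ) : ℂ) * Complex.exp (-(z * t)))
      Filter.atTop (nhds 0) := by
  rw [tendsto_zero_iff_norm_tendsto_zero]
  refine (tendsto_rpow_mul_exp_neg_mul_atTop_nhds_zero b z.re hz).congr' ?_
  filter_upwards [Filter.eventually_gt_atTop 0] with t ht
  rw [norm_rpow_mul_cexp b z ht]

/-- Expansion of the upper incomplete Gamma integral with explicit remainder. -/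
theorem integral_Ioi_one_rpow_mul_cexp {b : ℝ} (hb : -1 < b) (hb2 : b < 2) {z : ℂ}
    (hz : 0 < z.re) :
    ∫ t in Set.Ioi (1 : ℝ), ((t ^ b : ℝ) : ℂ) * Complex.exp (-(z * t))
      = Complex.exp (-z) * (1 / z + b / z ^ 2 + b * (b - 1) / z ^ 3)
        + b * (b - 1) * (b - 2) / z ^ 3
          * ∫ t in Set.Ioi (1 : ℝ), ((t ^ (b - 3) : ℝ) : ℂ) * Complex.exp (-(z * t)) := by
  have hz0 : z ≠ 0 := by
    rintro rfl
    simp at hz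
  have hi1 := (integrableOn_rpow_mul_cexp hb hz).mono_set (Set.Ioi_subset_Ioi zero_le_one)
  have hi2 := (integrableOn_Ioi_one_rpow_mul_cexp (b := b - 3) (by linarith) hz).const_mul
    ((b : ℂ) * (b - 1) * (b - 2) / z ^ 3)
  have hlim := ((((tendsto_rpow_mul_cexp_atTop b hz).div_const z).add
    (((tendsto_rpow_mul_cexp_atTop (b - 1) hz).const_mul (b : ℂ)).div_const (z ^ 2))).add
    (((tendsto_rpow_mul_cexp_atTop (b - 2) hz).const_mul
      ((b : ℂ) * (b - 1))).div_const (z ^ 3))).neg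
  have h := integral_Ioi_of_hasDerivAt_of_tendsto'
    (fun t (ht : t ∈ Set.Ici (1 : ℝ)) =>
      hasDerivAt_rpow_mul_cexp_primitive b hz0 (one_pos.trans_le ht))
    (hi1.sub hi2) (m := 0) (by
      refine (hlim.congr fun t => ?_).trans (by simp)
      ring)
  rw [MeasureTheory.integral_sub hi1 hi2, MeasureTheory.integral_const_mul] at h
  rw [sub_eq_iff_eq_add.1 h]
  simp

theorem norm_integral_rpow_mul_cexp_sub_le {b : ℝ} (hb : 0 ≤ b) (hb2 : b < 2) {z : ℂ}
    (hz : 0 < z.re) :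
    ‖(∫ t in (0 : ℝ)..1, ((t ^ b : ℝ) : ℂ) * Complex.exp (-(z * t)))
        - ((1 / z) ^ ((b + 1 : ℝ) : ℂ) * Real.Gamma (b + 1)
          - Complex.exp (-z) * (1 / z + b / z ^ 2))‖
      ≤ 2 * |b * (b - 1)| / ‖z‖ ^ 3 := by
  have hi := integrableOn_rpow_mul_cexp (b := b) (by linarith) hz
  have hG := integral_Ioi_rpow_mul_cexp (b := b) (by linarith) hz
  have hsplit := integral_Ioi_sub_Ioi (μ := volume) hi zero_le_one
  rw [← hsplit, hG, integral_Ioi_one_rpow_mul_cexp (by linarith) hb2 hz]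
  set J := ∫ t in Set.Ioi (1 : ℝ), ((t ^ (b - 3) : ℝ) : ℂ) * Complex.exp (-(z * t)) with hJ
  have hJn : ‖J‖ ≤ -1 / (b - 3 + 1) :=
    norm_integral_Ioi_one_rpow_mul_cexp_le (by linarith) hz
  have hJ1 : ‖((b - 2 : ℝ) : ℂ) * J‖ ≤ 1 := by
    rw [norm_mul, Complex.norm_real, Real.norm_of_nonpos (by linarith)]
    calc -(b - 2) * ‖J‖ ≤ -(b - 2) * (-1 / (b - 3 + 1)) := by gcongr; linarith
      _ = 1 := by
        have : b - 2 ≠ 0 := by linarith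
        rw [show b - 3 + 1 = b - 2 by ring]
        field_simp
  have hE : ‖Complex.exp (-z)‖ ≤ 1 := by
    rw [Complex.norm_exp, Real.exp_le_one_iff, Complex.neg_re]
    linarith
  have hrw (G : ℂ) : G - (Complex.exp (-z) * (1 / z + b / z ^ 2 + b * (b - 1) / z ^ 3)
        + b * (b - 1) * (b - 2) / z ^ 3 * J) - (G - Complex.exp (-z) * (1 / z + b / z ^ 2))
      = -(((b * (b - 1) : ℝ) : ℂ) * (Complex.exp (-z) + ((b - 2 : ℝ) : ℂ) * J) / z ^ 3) := by
    push_cast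
    ring
  rw [hrw, norm_neg, norm_div, norm_mul, norm_pow, Complex.norm_real, Real.norm_eq_abs,
    mul_comm 2]
  gcongr
  exact (norm_add_le _ _).trans (by linarith)

/-- The boundary case `z = i lam` of `norm_integral_rpow_mul_cexp_sub_le`. -/
theorem norm_integral_rpow_mul_cexp_I_sub_le {b : ℝ} (hb : 0 ≤ b) (hb2 : b < 2) {lam : ℝ}
    (hlam : 0 < lam) :
    ‖(∫ t in (0 : ℝ)..1, ((t ^ b : ℝ) : ℂ) * Complex.exp (-(lam * Complex.I * t)))
        - ((1 / (lam * Complex.I)) ^ ((b + 1 : ℝ) : ℂ) * Real.Gamma (b + 1)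
          - Complex.exp (-(lam * Complex.I))
            * (1 / (lam * Complex.I) + b / (lam * Complex.I) ^ 2))‖
      ≤ 2 * |b * (b - 1)| / lam ^ 3 := by
  have hz0 : (((0 : ℝ) : ℂ) + lam * Complex.I) ≠ 0 := by
    simp [hlam.ne']
  have hcont : Continuous fun ε : ℝ => ∫ t in (0 : ℝ)..1,
      ((t ^ b : ℝ) : ℂ) * Complex.exp (-((ε + lam * Complex.I) * t)) := by
    apply continuous_parametric_intervalIntegral_of_continuous'
    have : Continuous fun p : ℝ × ℝ => p.2 ^ b := continuous_snd.rpow_const fun _ => Or.inr hb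
    simp only [Function.uncurry_def]
    fun_prop
  have hzc : ContinuousAt (fun ε : ℝ => (ε : ℂ) + lam * Complex.I) 0 := by fun_prop
  have hinv : ContinuousAt (fun ε : ℝ => 1 / ((ε : ℂ) + lam * Complex.I)) 0 :=
    continuousAt_const.div hzc hz0
  have hslit : 1 / (((0 : ℝ) : ℂ) + lam * Complex.I) ∈ Complex.slitPlane := by
    refine Complex.mem_slitPlane_iff.2 (Or.inr ?_)
    simp [hlam.ne']
  have hleft : ContinuousAt (fun ε : ℝ =>
      ‖(∫ t in (0 : ℝ)..1, ((t ^ b : ℝ) : ℂ) * Complex.exp (-((ε + lam * Complex.I) * t)))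
        - ((1 / (ε + lam * Complex.I)) ^ ((b + 1 : ℝ) : ℂ) * Real.Gamma (b + 1)
          - Complex.exp (-(ε + lam * Complex.I))
            * (1 / (ε + lam * Complex.I) + b / (ε + lam * Complex.I) ^ 2))‖) 0 :=
    (hcont.continuousAt.sub (((hinv.cpow continuousAt_const hslit).mul continuousAt_const).sub
      (hzc.neg.cexp.mul
        (hinv.add (continuousAt_const.div (hzc.pow 2) (pow_ne_zero 2 hz0)))))).norm
  have hright : ContinuousAt (fun ε : ℝ =>
      2 * |b * (b - 1)| / ‖(ε : ℂ) + lam * Complex.I‖ ^ 3) 0 :=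
    continuousAt_const.div (hzc.norm.pow 3) (pow_ne_zero 3 (norm_ne_zero_iff.2 hz0))
  have h := le_of_tendsto_of_tendsto (b := nhdsWithin (0 : ℝ) (Set.Ioi 0))
    (hleft.tendsto.mono_left nhdsWithin_le_nhds) (hright.tendsto.mono_left nhdsWithin_le_nhds) (by
      filter_upwards [self_mem_nhdsWithin] with ε hε
      exact norm_integral_rpow_mul_cexp_sub_le hb hb2 (by simpa using hε))
  simpa [abs_of_pos hlam] using h

theorem one_div_mul_I_cpow {lam : ℝ} (hlam : 0 < lam) (a : ℝ) :
    (1 / (lam * Complex.I)) ^ (a : ℂ)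
      = ((lam ^ (-a) : ℝ) : ℂ) * Complex.exp (((-(Real.pi * a / 2) : ℝ) : ℂ) * Complex.I) := by
  have h : (1 / (lam * Complex.I) : ℂ) = ((lam⁻¹ : ℝ) : ℂ) * -Complex.I := by
    simp [mul_comm]
  have h0 : ((lam⁻¹ : ℝ) : ℂ) * -Complex.I ≠ 0 := by simp [hlam.ne']
  rw [h, Complex.cpow_def_of_ne_zero h0, Complex.log_ofReal_mul (inv_pos.2 hlam) (by simp),
    Complex.log_neg_I, Real.rpow_def_of_pos hlam, Real.log_inv, Complex.ofReal_exp,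
    ← Complex.exp_add]
  push_cast
  ring_nf

theorem stmt_3 (s : ℝ) (hs0 : 0 < s) (hs1 : s < 1) :
    ∃ C > (0 : ℝ), ∃ lam0 : ℝ, 1 ≤ lam0 ∧ ∀ lam : ℝ, lam0 ≤ lam →
      |(∫ t in (0 : ℝ)..1, t ^ (2 * s) * Real.cos (lam * t))
          - (Real.sin lam / lam + 2 * s * Real.cos lam / lam ^ 2
              - Real.Gamma (2 * s + 1) * Real.sin (Real.pi * s) * lam ^ (-(1 + 2 * s)))|
        ≤ C * (lam ^ (-(2 + 2 * s)) + lam ^ (-(3 : ℝ))) := by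
  refine ⟨2 * |2 * s * (2 * s - 1)| + 1, by positivity, 1, le_rfl, fun lam hlam => ?_⟩
  have hpos : 0 < lam := one_pos.trans_le hlam
  have h := (Complex.abs_re_le_norm _).trans
    (norm_integral_rpow_mul_cexp_I_sub_le (b := 2 * s) (by linarith) (by linarith) hpos)
  have hi : IntervalIntegrable (fun t : ℝ => ((t ^ (2 * s) : ℝ) : ℂ)
      * Complex.exp (-(lam * Complex.I * t))) volume 0 1 := by
    have : Continuous fun t : ℝ => t ^ (2 * s) :=
      continuous_id.rpow_const fun _ => Or.inr (by linarith)
    exact Continuous.intervalIntegrable (by fun_prop) _ _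
  have hexp (x : ℝ) : Complex.exp (-(lam * Complex.I * x))
      = ((Real.cos (lam * x) : ℝ) : ℂ) - ((Real.sin (lam * x) : ℝ) : ℂ) * Complex.I := by
    rw [show -(lam * Complex.I * x) = ((-(lam * x) : ℝ) : ℂ) * Complex.I by push_cast; ring,
      Complex.exp_mul_I, ← Complex.ofReal_cos, ← Complex.ofReal_sin, Real.cos_neg, Real.sin_neg]
    push_cast
    ring
  have hre : (∫ t in (0 : ℝ)..1, ((t ^ (2 * s) : ℝ) : ℂ)
      * Complex.exp (-(lam * Complex.I * t))).re
      = ∫ t in (0 : ℝ)..1, t ^ (2 * s) * Real.cos (lam * t) := by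
    rw [← Complex.reCLM_apply, ← Complex.reCLM.intervalIntegral_comp_comm hi]
    refine integral_congr fun t _ => ?_
    rw [Complex.reCLM_apply, Complex.re_ofReal_mul, hexp, Complex.sub_re, Complex.re_ofReal_mul,
      Complex.ofReal_re, Complex.I_re, mul_zero, sub_zero]
  have hG : ((1 / (lam * Complex.I)) ^ ((2 * s + 1 : ℝ) : ℂ) * Real.Gamma (2 * s + 1)).re
      = -(Real.Gamma (2 * s + 1) * Real.sin (Real.pi * s) * lam ^ (-(1 + 2 * s))) := by
    rw [one_div_mul_I_cpow hpos, Complex.re_mul_ofReal, Complex.re_ofReal_mul,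
      Complex.exp_ofReal_mul_I_re, Real.cos_neg,
      show Real.pi * (2 * s + 1) / 2 = Real.pi * s + Real.pi / 2 by ring,
      Real.cos_add_pi_div_two, add_comm 1]
    ring
  have hB : (Complex.exp (-(lam * Complex.I))
      * (1 / (lam * Complex.I) + ((2 * s : ℝ) : ℂ) / (lam * Complex.I) ^ 2)).re
      = -(Real.sin lam / lam + 2 * s * Real.cos lam / lam ^ 2) := by
    have h1 := hexp 1
    rw [Complex.ofReal_one, mul_one, mul_one] at h1
    have h2 : (1 / (lam * Complex.I) + ((2 * s : ℝ) : ℂ) / (lam * Complex.I) ^ 2 : ℂ)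
        = ((-(2 * s / lam ^ 2) : ℝ) : ℂ) + ((-lam⁻¹ : ℝ) : ℂ) * Complex.I := by
      rw [mul_pow, Complex.I_sq, one_div, mul_inv, Complex.inv_I]
      push_cast
      ring
    rw [h1, h2]
    simp only [Complex.mul_re, Complex.sub_re, Complex.add_re, Complex.sub_im, Complex.add_im,
      Complex.mul_im, Complex.ofReal_re, Complex.ofReal_im, Complex.I_re, Complex.I_im]
    ring
  rw [Complex.sub_re, Complex.sub_re, hre, hG, hB] at h
  have hp : lam ^ (-(3 : ℝ)) = 1 / lam ^ 3 := by
    rw [Real.rpow_neg hpos.le, one_div]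
    norm_cast
  have hq : 0 ≤ lam ^ (-(2 + 2 * s)) := Real.rpow_nonneg hpos.le _
  have hr : 0 ≤ 1 / lam ^ 3 := by positivity
  have hA := abs_nonneg (2 * s * (2 * s - 1))
  calc _ = _ := by
        congr 1
        ring
    _ ≤ _ := h
    _ = 2 * |2 * s * (2 * s - 1)| * (1 / lam ^ 3) := by ring
    _ ≤ _ := by
        rw [hp]
        nlinarith [mul_nonneg hA hq, mul_nonneg hA hr]
end

section
/- Let s ∈ (0,1) and let p be a nonnegative integer. Then (1/(2π)) ∫_{−π}^{π} (4 sin²(ξ/2))^s e^{i p ξ} dξ = (−1)^p Γ(2s+1) / (Γ(p+s+1) Γ(s−p+1)), where Γ is the real Gamma function (note that s−p+1 is never a nonpositive integer since s is not an integer). -/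
open MeasureTheory intervalIntegral

lemma image_half_one_sub_cos :
    (fun x : ℝ => (1 - Real.cos x) / 2) '' Set.Ioo 0 Real.pi = Set.Ioo 0 1 := by
  ext t
  constructor
  · rintro ⟨x, ⟨hx0, hx1⟩, rfl⟩
    have hs := Real.sin_pos_of_pos_of_lt_pi hx0 hx1
    have hsc := Real.sin_sq_add_cos_sq x
    constructor <;> dsimp only <;> nlinarith
  · rintro ⟨h0, h1⟩
    refine ⟨Real.arccos (1 - 2 * t), ⟨Real.arccos_pos.2 (by linarith), ?_⟩, ?_⟩
    · refine lt_of_le_of_ne (Real.arccos_le_pi _) fun h => ?_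
      rw [Real.arccos_eq_pi] at h
      linarith
    · dsimp only
      rw [Real.cos_arccos (by linarith) (by linarith)]
      ring

lemma sin_div_two_mul_rpow_half_one_sub_cos (s : ℝ) {x : ℝ} (hx : x ∈ Set.Ioo 0 Real.pi) :
    |Real.sin x / 2| * (((1 - Real.cos x) / 2) ^ (s - 1 / 2) *
      (1 - (1 - Real.cos x) / 2) ^ (s - 1 / 2)) = (4 ^ s)⁻¹ * Real.sin x ^ (2 * s) := by
  have hs := Real.sin_pos_of_pos_of_lt_pi hx.1 hx.2
  have hsc := Real.sin_sq_add_cos_sq x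
  have h2 : 0 < Real.sin x / 2 := by positivity
  rw [abs_of_pos h2, ← Real.mul_rpow (by nlinarith) (by nlinarith),
    show (1 - Real.cos x) / 2 * (1 - (1 - Real.cos x) / 2) = (Real.sin x / 2) ^ (2 : ℝ) by
      rw [Real.rpow_two]; linarith,
    ← Real.rpow_mul h2.le, mul_comm, ← Real.rpow_add_one h2.ne',
    show 2 * (s - 1 / 2) + 1 = 2 * s by ring, Real.div_rpow hs.le zero_le_two,
    Real.rpow_mul zero_le_two]
  norm_num
  ring

/-- The Beta integral `B(s + 1/2, s + 1/2)` in trigonometric form. -/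
lemma integral_sin_rpow_two_mul {s : ℝ} (hs : -(1 / 2) < s) :
    ∫ x in (0 : ℝ)..Real.pi, ((Real.sin x ^ (2 * s) : ℝ) : ℂ) =
      ((4 ^ s * (Real.Gamma (s + 1 / 2) ^ 2 / Real.Gamma (2 * s + 1)) : ℝ) : ℂ) := by
  have hbeta : Complex.betaIntegral ((s + 1 / 2 : ℝ) : ℂ) ((s + 1 / 2 : ℝ) : ℂ) =
      ((Real.Gamma (s + 1 / 2) ^ 2 / Real.Gamma (2 * s + 1) : ℝ) : ℂ) := by
    have hpos : 0 < ((s + 1 / 2 : ℝ) : ℂ).re := by rw [Complex.ofReal_re]; linarith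
    rw [Complex.betaIntegral_eq_Gamma_mul_div _ _ hpos hpos, ← Complex.ofReal_add,
      Complex.Gamma_ofReal, Complex.Gamma_ofReal, show s + 1 / 2 + (s + 1 / 2) = 2 * s + 1 by ring]
    push_cast
    ring
  have hsubst := integral_image_eq_integral_abs_deriv_smul (s := Set.Ioo 0 Real.pi)
    (f := fun x => (1 - Real.cos x) / 2) (f' := fun x => Real.sin x / 2) measurableSet_Ioo
    (fun x _ => by
      simpa using (((Real.hasDerivAt_cos x).const_sub 1).div_const 2).hasDerivWithinAt)
    (fun x hx y hy hxy => Real.injOn_cos (Set.Ioo_subset_Icc_self hx)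
      (Set.Ioo_subset_Icc_self hy) (by dsimp only at hxy; linarith))
    (fun t : ℝ => (t : ℂ) ^ (((s + 1 / 2 : ℝ) : ℂ) - 1) *
      (1 - (t : ℂ)) ^ (((s + 1 / 2 : ℝ) : ℂ) - 1))
  rw [image_half_one_sub_cos, ← integral_Ioc_eq_integral_Ioo,
    ← intervalIntegral.integral_of_le zero_le_one] at hsubst
  change Complex.betaIntegral _ _ = _ at hsubst
  have hcongr : ∀ x ∈ Set.Ioo 0 Real.pi, |Real.sin x / 2| •
      ((((1 - Real.cos x) / 2 : ℝ) : ℂ) ^ (((s + 1 / 2 : ℝ) : ℂ) - 1) *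
        (1 - (((1 - Real.cos x) / 2 : ℝ) : ℂ)) ^ (((s + 1 / 2 : ℝ) : ℂ) - 1)) =
      (((4 : ℝ) ^ s)⁻¹ : ℝ) • ((Real.sin x ^ (2 * s) : ℝ) : ℂ) := by
    intro x hx
    have hc := Real.cos_le_one x
    have hc' := Real.neg_one_le_cos x
    rw [← Complex.ofReal_one, ← Complex.ofReal_sub, ← Complex.ofReal_sub,
      ← Complex.ofReal_cpow (by linarith), ← Complex.ofReal_cpow (by linarith),
      ← Complex.ofReal_mul, Complex.real_smul, Complex.real_smul, ← Complex.ofReal_mul,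
      ← Complex.ofReal_mul, ← sin_div_two_mul_rpow_half_one_sub_cos s hx,
      show s + 1 / 2 - 1 = s - 1 / 2 by ring]
  rw [setIntegral_congr_fun measurableSet_Ioo hcongr, MeasureTheory.integral_smul, hbeta,
    ← integral_Ioc_eq_integral_Ioo, ← intervalIntegral.integral_of_le Real.pi_pos.le,
    Complex.real_smul] at hsubst
  have h4 : (((4 : ℝ) ^ s : ℝ) : ℂ) ≠ 0 :=
    Complex.ofReal_ne_zero.2 (Real.rpow_pos_of_pos (by norm_num) s).ne'
  rw [Complex.ofReal_mul, hsubst, Complex.ofReal_inv, mul_inv_cancel_left₀ h4]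

lemma intervalIntegrable_sin_rpow_mul_exp {s : ℝ} (hs : 0 ≤ s) (p : ℕ) :
    IntervalIntegrable (fun x : ℝ => ((Real.sin x ^ (2 * s) : ℝ) : ℂ) *
      Complex.exp (Complex.I * p * (2 * x))) volume 0 Real.pi := by
  refine Continuous.intervalIntegrable ?_ _ _
  have : Continuous fun x : ℝ => Real.sin x ^ (2 * s) :=
    Real.continuous_sin.rpow_const fun _ => Or.inr (by linarith)
  fun_prop

/-- The recurrence comes from integrating the derivative of `sin x ^ (2s+1) * e^{i(2p+1)x}`. -/
lemma integral_sin_rpow_mul_exp_succ {s : ℝ} (hs : 0 ≤ s) (p : ℕ) :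
    ((s + p + 1 : ℝ) : ℂ) * (∫ x in (0 : ℝ)..Real.pi, ((Real.sin x ^ (2 * s) : ℝ) : ℂ) *
        Complex.exp (Complex.I * (p + 1 : ℕ) * (2 * x))) =
      -((s - p : ℝ) : ℂ) * ∫ x in (0 : ℝ)..Real.pi, ((Real.sin x ^ (2 * s) : ℝ) : ℂ) *
        Complex.exp (Complex.I * p * (2 * x)) := by
  have hderiv : ∀ x ∈ Set.uIcc 0 Real.pi, HasDerivAt
      (fun x : ℝ => ((Real.sin x ^ (2 * s + 1) : ℝ) : ℂ) *
        Complex.exp (Complex.I * (2 * p + 1) * x))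
      (((s + p + 1 : ℝ) : ℂ) * (((Real.sin x ^ (2 * s) : ℝ) : ℂ) *
          Complex.exp (Complex.I * (p + 1 : ℕ) * (2 * x))) +
        ((s - p : ℝ) : ℂ) * (((Real.sin x ^ (2 * s) : ℝ) : ℂ) *
          Complex.exp (Complex.I * p * (2 * x)))) x := by
    intro x hx
    rw [Set.uIcc_of_le Real.pi_pos.le] at hx
    have h1 := ((Real.hasDerivAt_sin x).rpow_const (p := 2 * s + 1)
      (Or.inr (by linarith))).ofReal_comp
    have h2 : HasDerivAt (fun x : ℝ => Complex.exp (Complex.I * (2 * p + 1) * x))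
        (Complex.exp (Complex.I * (2 * p + 1) * x) * (Complex.I * (2 * p + 1))) x := by
      simpa using ((Complex.ofRealCLM.hasDerivAt (x := x)).const_mul
        (Complex.I * (2 * p + 1))).cexp
    refine (h1.mul h2).congr_deriv ?_
    rw [add_sub_cancel_right, Real.rpow_add_one' (Real.sin_nonneg_of_mem_Icc hx) (by linarith)]
    push_cast
    rw [Complex.cos, Complex.sin,
      show Complex.I * (p + 1) * (2 * x) = Complex.I * (2 * p + 1) * x + x * Complex.I by ring,
      show Complex.I * p * (2 * x) = Complex.I * (2 * p + 1) * x + -x * Complex.I by ring,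
      Complex.exp_add, Complex.exp_add]
    linear_combination (-(Complex.exp (x * Complex.I) - Complex.exp (-x * Complex.I)) / 2 *
      ((Real.sin x ^ (2 * s) : ℝ) : ℂ) * Complex.exp (Complex.I * (2 * p + 1) * x) *
      (2 * p + 1)) * Complex.I_sq
  have hint1 := (intervalIntegrable_sin_rpow_mul_exp hs (p + 1)).const_mul ((s + p + 1 : ℝ) : ℂ)
  have hint2 := (intervalIntegrable_sin_rpow_mul_exp hs p).const_mul ((s - p : ℝ) : ℂ)
  have h := integral_eq_sub_of_hasDerivAt hderiv (hint1.add hint2)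
  rw [intervalIntegral.integral_add hint1 hint2, intervalIntegral.integral_const_mul,
    intervalIntegral.integral_const_mul] at h
  simp only [Real.sin_pi, Real.sin_zero, Real.zero_rpow (by linarith : 2 * s + 1 ≠ 0),
    Complex.ofReal_zero, zero_mul, sub_self] at h
  linear_combination h

lemma integral_sin_rpow_mul_exp {s : ℝ} (hs0 : 0 ≤ s) (hs : ∀ n : ℕ, s ≠ n) (p : ℕ) :
    ∫ x in (0 : ℝ)..Real.pi, ((Real.sin x ^ (2 * s) : ℝ) : ℂ) *
        Complex.exp (Complex.I * p * (2 * x)) =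
      ((Real.pi * (4 ^ s)⁻¹ * ((-1) ^ p * Real.Gamma (2 * s + 1) /
        (Real.Gamma (p + s + 1) * Real.Gamma (s - p + 1))) : ℝ) : ℂ) := by
  induction p with
  | zero =>
    have hG := Real.Gamma_mul_Gamma_add_half (s + 1 / 2)
    rw [show s + 1 / 2 + 1 / 2 = s + 1 by ring, show 2 * (s + 1 / 2) = 2 * s + 1 by ring,
      show 1 - (2 * s + 1) = -(2 * s) by ring, Real.rpow_neg zero_le_two,
      Real.rpow_mul zero_le_two, show (2 : ℝ) ^ (2 : ℝ) = 4 by norm_num] at hG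
    have h1 : Real.Gamma (s + 1) ≠ 0 := (Real.Gamma_pos_of_pos (by linarith)).ne'
    have h2 : Real.Gamma (2 * s + 1) ≠ 0 := (Real.Gamma_pos_of_pos (by linarith)).ne'
    have h4 : (4 : ℝ) ^ s ≠ 0 := (Real.rpow_pos_of_pos (by norm_num) s).ne'
    simp only [Nat.cast_zero, mul_zero, zero_mul, Complex.exp_zero, mul_one, pow_zero, one_mul,
      zero_add, sub_zero]
    rw [integral_sin_rpow_two_mul (by linarith), eq_div_of_mul_eq h1 hG]
    congr 1
    field_simp
    rw [Real.sq_sqrt Real.pi_pos.le]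
  | succ p ih =>
    have h := integral_sin_rpow_mul_exp_succ hs0 p
    have hp : s + p + 1 ≠ 0 := by positivity
    have hsp : s - p ≠ 0 := sub_ne_zero.2 (hs p)
    rw [ih, ← Complex.ofReal_neg, ← Complex.ofReal_mul] at h
    refine mul_left_cancel₀ (Complex.ofReal_ne_zero.2 hp) (h.trans ?_)
    rw [← Complex.ofReal_mul, Complex.ofReal_inj, Nat.cast_succ,
      show (p : ℝ) + 1 + s + 1 = (s + p + 1) + 1 by ring,
      show s - (p + 1 : ℝ) + 1 = s - p by ring, Real.Gamma_add_one hp, Real.Gamma_add_one hsp,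
      show (p : ℝ) + s + 1 = s + p + 1 by ring, pow_succ]
    simp only [div_eq_mul_inv, mul_inv]
    field_simp

theorem stmt_6 (s : ℝ) (hs0 : 0 < s) (hs1 : s < 1) (p : ℕ) :
    ((1 / (2 * Real.pi) : ℝ) : ℂ) *
        ∫ ξ in (-Real.pi)..Real.pi,
          (((4 * Real.sin (ξ / 2) ^ 2) ^ s : ℝ) : ℂ) *
            Complex.exp (Complex.I * (p : ℂ) * (ξ : ℂ))
      = (((-1 : ℝ) ^ p * Real.Gamma (2 * s + 1) /
          (Real.Gamma ((p : ℝ) + s + 1) * Real.Gamma (s - (p : ℝ) + 1)) : ℝ) : ℂ) := by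
  have hper : Function.Periodic (fun ξ : ℝ => (((4 * Real.sin (ξ / 2) ^ 2) ^ s : ℝ) : ℂ) *
      Complex.exp (Complex.I * (p : ℂ) * (ξ : ℂ))) (2 * Real.pi) := by
    intro ξ
    have hexp : Complex.exp (Complex.I * p * ((ξ + 2 * Real.pi : ℝ) : ℂ)) =
        Complex.exp (Complex.I * p * ξ) := by
      rw [Complex.exp_eq_exp_iff_exists_int]
      exact ⟨p, by push_cast; ring⟩
    dsimp only
    rw [hexp, show (ξ + 2 * Real.pi) / 2 = ξ / 2 + Real.pi by ring, Real.sin_add_pi, neg_sq]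
  have hshift := hper.intervalIntegral_add_eq (-Real.pi) 0
  rw [show -Real.pi + 2 * Real.pi = Real.pi by ring, zero_add] at hshift
  have hscale := intervalIntegral.integral_comp_div (a := 0) (b := 2 * Real.pi) (c := 2)
    (fun x : ℝ => (((4 * Real.sin x ^ 2) ^ s : ℝ) : ℂ) *
      Complex.exp (Complex.I * p * (2 * x))) two_ne_zero
  rw [zero_div, mul_div_cancel_left₀ _ two_ne_zero] at hscale
  have hcongr : ∀ x ∈ Set.uIcc 0 Real.pi, (((4 * Real.sin x ^ 2) ^ s : ℝ) : ℂ) *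
      Complex.exp (Complex.I * p * (2 * x)) = (((4 : ℝ) ^ s : ℝ) : ℂ) *
        (((Real.sin x ^ (2 * s) : ℝ) : ℂ) * Complex.exp (Complex.I * p * (2 * x))) := by
    intro x hx
    rw [Set.uIcc_of_le Real.pi_pos.le] at hx
    rw [Real.mul_rpow (by norm_num) (sq_nonneg _),
      Real.rpow_mul (Real.sin_nonneg_of_mem_Icc hx), Real.rpow_two, Complex.ofReal_mul, mul_assoc]
  have hs : ∀ n : ℕ, s ≠ n := by
    rintro n rfl
    norm_cast at hs0 hs1
    omega
  rw [intervalIntegral.integral_congr hcongr, intervalIntegral.integral_const_mul,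
    integral_sin_rpow_mul_exp hs0.le hs] at hscale
  have h4 : (4 : ℝ) ^ s ≠ 0 := (Real.rpow_pos_of_pos (by norm_num) s).ne'
  rw [hshift]
  trans ((1 / (2 * Real.pi) : ℝ) : ℂ) * ((2 : ℝ) • ((((4 : ℝ) ^ s : ℝ) : ℂ) *
    ((Real.pi * (4 ^ s)⁻¹ * ((-1) ^ p * Real.Gamma (2 * s + 1) /
        (Real.Gamma (p + s + 1) * Real.Gamma (s - p + 1))) : ℝ) : ℂ)))
  · rw [← hscale]
    congr 2
    ext ξ
    congr 3
    push_cast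
    ring
  · rw [Complex.real_smul, ← Complex.ofReal_mul, ← Complex.ofReal_mul, ← Complex.ofReal_mul]
    congr 1
    have := Real.pi_ne_zero
    field_simp
end

section
/- Let s ∈ (0,1) and for nonnegative integers p set T_p = (−1)^p Γ(2s+1) / (Γ(p+s+1) Γ(s−p+1)). Then lim_{p→∞} p^{1+2s} T_p = −Γ(2s+1) sin(πs)/π; in particular T_p = O(p^{-(1+2s)}) as p → ∞. -/
open Filter

/-- Closed-form entries of the 1D stiffness matrix of the uniform-grid finite difference
approximation of the fractional Laplacian. -/
noncomputable def Tfd1 (s : ℝ) (p : ℕ) : ℝ :=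
  (-1 : ℝ) ^ p * Real.Gamma (2 * s + 1) /
    (Real.Gamma ((p : ℝ) + s + 1) * Real.Gamma (s - (p : ℝ) + 1))

theorem Real.Gamma_add_natCast_eq_prod_mul {x : ℝ} (hx : ∀ m : ℕ, x ≠ -m) (n : ℕ) :
    Real.Gamma (x + n) = (∏ j ∈ Finset.range n, (x + j)) * Real.Gamma x := by
  induction n with
  | zero => simp
  | succ n ih =>
    have h : x + n ≠ 0 := fun h => hx n (eq_neg_of_add_eq_zero_left h)
    rw [Nat.cast_succ, ← add_assoc, Real.Gamma_add_one h, ih, Finset.prod_range_succ]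
    ring

theorem Real.tendsto_rpow_mul_factorial_div_Gamma {x : ℝ} (hx : ∀ m : ℕ, x ≠ -m) :
    Tendsto (fun n : ℕ => (n : ℝ) ^ x * (n.factorial : ℝ) / Real.Gamma (x + n + 1)) atTop
      (nhds 1) := by
  have hG : Real.Gamma x ≠ 0 := Real.Gamma_ne_zero hx
  have h := (Real.GammaSeq_tendsto_Gamma x).div_const (Real.Gamma x)
  rw [div_self hG] at h
  refine h.congr fun n => ?_
  have hprod := Real.Gamma_add_natCast_eq_prod_mul hx (n + 1)
  rw [Nat.cast_succ, ← add_assoc] at hprod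
  rw [hprod, Real.GammaSeq, div_div]

theorem Real.tendsto_rpow_mul_Gamma_sub_div_Gamma {s : ℝ} (hs0 : 0 < s) (hs1 : s < 1) :
    Tendsto (fun p : ℕ => (p : ℝ) ^ (1 + 2 * s) *
      (Real.Gamma (p - s) / Real.Gamma (p + s + 1))) atTop (nhds 1) := by
  have h₁ : ∀ m : ℕ, s ≠ -m := fun m h => by
    have : (0 : ℝ) ≤ m := m.cast_nonneg
    linarith
  have h₂ : ∀ m : ℕ, -s - 1 ≠ -(m : ℝ) := fun m h => by
    have hlo : (1 : ℝ) < m := by linarith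
    have hhi : (m : ℝ) < 2 := by linarith
    norm_cast at hlo hhi
    omega
  have h := (Real.tendsto_rpow_mul_factorial_div_Gamma h₁).div
    (Real.tendsto_rpow_mul_factorial_div_Gamma h₂) one_ne_zero
  rw [div_one] at h
  refine h.congr' ?_
  filter_upwards [eventually_gt_atTop 0] with p hp
  have hp' : (0 : ℝ) < p := by exact_mod_cast hp
  have hf : (p.factorial : ℝ) ≠ 0 := by exact_mod_cast p.factorial_ne_zero
  have hpow : (p : ℝ) ^ s = (p : ℝ) ^ (1 + 2 * s) * (p : ℝ) ^ (-s - 1) := by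
    rw [← Real.rpow_add hp']
    congr 1
    ring
  have hne : (p : ℝ) ^ (-s - 1) ≠ 0 := (Real.rpow_pos_of_pos hp' _).ne'
  rw [Pi.div_apply, hpow, show -s - 1 + (p : ℝ) + 1 = p - s by ring, add_comm s (p : ℝ)]
  field_simp

theorem Tfd1_eq {s : ℝ} (hs0 : 0 < s) (hs1 : s < 1) (p : ℕ) :
    Tfd1 s p = -(Real.Gamma (2 * s + 1) * Real.sin (Real.pi * s) / Real.pi) *
      (Real.Gamma (p - s) / Real.Gamma (p + s + 1)) := by
  have hrefl := Real.Gamma_mul_Gamma_one_sub (s - p + 1)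
  have hsin : Real.sin (Real.pi * (s - p + 1)) = -((-1) ^ p * Real.sin (Real.pi * s)) := by
    rw [show Real.pi * (s - p + 1) = Real.pi * s - p * Real.pi + Real.pi by ring,
      Real.sin_add_pi, Real.sin_sub_nat_mul_pi]
  have hsin_pos : 0 < Real.sin (Real.pi * s) :=
    Real.sin_pos_of_pos_of_lt_pi (by positivity) (by nlinarith [Real.pi_pos])
  have hsign : ((-1 : ℝ) ^ p) ^ 2 = 1 := by rw [← pow_mul, mul_comm, pow_mul]; norm_num
  have hsign_ne : (-1 : ℝ) ^ p ≠ 0 := pow_ne_zero _ (by norm_num)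
  rw [hsin, show 1 - (s - (p : ℝ) + 1) = p - s by ring] at hrefl
  have hprod : Real.Gamma (s - p + 1) * Real.Gamma (p - s) ≠ 0 := by
    rw [hrefl]
    exact div_ne_zero Real.pi_ne_zero (neg_ne_zero.mpr (mul_ne_zero hsign_ne hsin_pos.ne'))
  have hG := left_ne_zero_of_mul hprod
  have hGp : Real.Gamma (p + s + 1) ≠ 0 := (Real.Gamma_pos_of_pos (by positivity)).ne'
  have hpi := Real.pi_ne_zero
  rw [eq_div_iff (neg_ne_zero.mpr (mul_ne_zero hsign_ne hsin_pos.ne'))] at hrefl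
  rw [Tfd1]
  generalize Real.sin (Real.pi * s) = c at hrefl ⊢
  field_simp
  linear_combination (-(-1 : ℝ) ^ p) * hrefl
    - c * Real.Gamma (s - p + 1) * Real.Gamma (p - s) * hsign

theorem stmt_7 (s : ℝ) (hs0 : 0 < s) (hs1 : s < 1) :
    Tendsto (fun p : ℕ => (p : ℝ) ^ (1 + 2 * s) * Tfd1 s p) atTop
        (nhds (-(Real.Gamma (2 * s + 1) * Real.sin (Real.pi * s) / Real.pi)))
    ∧ ∃ C > (0 : ℝ), ∃ P : ℕ, ∀ p : ℕ, P ≤ p →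
        |Tfd1 s p| ≤ C * (p : ℝ) ^ (-(1 + 2 * s)) := by
  have hlim : Tendsto (fun p : ℕ => (p : ℝ) ^ (1 + 2 * s) * Tfd1 s p) atTop
      (nhds (-(Real.Gamma (2 * s + 1) * Real.sin (Real.pi * s) / Real.pi))) := by
    have h := (Real.tendsto_rpow_mul_Gamma_sub_div_Gamma hs0 hs1).const_mul
      (-(Real.Gamma (2 * s + 1) * Real.sin (Real.pi * s) / Real.pi))
    rw [mul_one] at h
    refine h.congr fun p => ?_
    rw [Tfd1_eq hs0 hs1]
    ring
  refine ⟨hlim, ?_⟩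
  set L := -(Real.Gamma (2 * s + 1) * Real.sin (Real.pi * s) / Real.pi)
  have hbound := hlim.abs.eventually_le_const (lt_add_one |L|)
  obtain ⟨P, hP⟩ := eventually_atTop.mp (hbound.and (eventually_gt_atTop 0))
  refine ⟨|L| + 1, by positivity, P, fun p hp => ?_⟩
  obtain ⟨hle, hpos⟩ := hP p hp
  have hpow : 0 < (p : ℝ) ^ (1 + 2 * s) := Real.rpow_pos_of_pos (by exact_mod_cast hpos) _
  rw [abs_mul, abs_of_pos hpow] at hle
  rw [Real.rpow_neg p.cast_nonneg, ← div_eq_mul_inv, le_div_iff₀ hpow, mul_comm]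
  exact hle
end
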